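/- arXiv:1204.1992 — 5 statements merged into one kernel-verified Lean document; each statement's English description precedes it below -/
import Mathlib

section
/- For every M > 0 and every θ ∈ Θ with I(θ − θ*) ≤ M, the expected deviation of the centered empirical loss satisfies E[Z_θ] ≤ ā_n · M, where ā_n = 4 a_n. (Lemma 3.1) -/
open MeasureTheory ProbabilityTheory Real Finset

universe u v

lemma aux_abs {Ω : Type*} [MeasurableSpace Ω] (P : Measure Ω) [IsProbabilityMeasure P]
    (U : Ω → ℝ) (hU : MemLp U 2 P) : ∫ ω, |U ω - ∫ ω', U ω' ∂P| ∂P ≤ Real.sqrt (variance U P) := by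
  have h1 : MemLp (fun ω => U ω - ∫ ω', U ω' ∂P) 2 P := hU.sub (memLp_const _)
  have h2 : MemLp (fun ω => |U ω - ∫ ω', U ω' ∂P|) 2 P := h1.abs
  have h3 := variance_nonneg (fun ω => |U ω - ∫ ω', U ω' ∂P|) P
  rw [variance_eq_sub h2] at h3
  apply Real.le_sqrt_of_sq_le
  rw [variance_eq_integral hU.aestronglyMeasurable.aemeasurable]
  simp only [Pi.pow_apply, sq_abs] at h3
  linarith

lemma aux_mean {Ω : Type*} [MeasurableSpace Ω] (P : Measure Ω) [IsProbabilityMeasure P]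
    (n : ℕ) (hn : 0 < n) (W : Fin n → Ω → ℝ) (hW : ∀ i, Measurable (W i))
    (hind : iIndepFun W P) (B e : ℝ) (hB0 : 0 ≤ B) (hB : ∀ i, ∀ᵐ ω ∂P, |W i ω| ≤ B)
    (he : ∀ i, ∫ ω, W i ω ∂P = e) :
    ∫ ω, |(n:ℝ)⁻¹ * ∑ i, W i ω - e| ∂P ≤ B / Real.sqrt n := by
  have hn' : (0:ℝ) < n := by exact_mod_cast hn
  have hL : ∀ i, MemLp (W i) 2 P := fun i =>
    MemLp.of_bound (hW i).aestronglyMeasurable B (by simpa using hB i)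
  have hLS : MemLp (∑ i, W i) 2 P := memLp_finsetSum' _ (fun i _ => hL i)
  have hv : variance (∑ i, W i) P ≤ n * B^2 := by
    rw [IndepFun.variance_sum (fun i _ => hL i) (fun i _ j _ hij => hind.indepFun hij)]
    calc ∑ i, variance (W i) P ≤ ∑ i : Fin n, B^2 := by
          apply Finset.sum_le_sum
          intro i _
          have := variance_le_sq_of_bounded (a := -B) (b := B) (μ := P) (X := W i)
            (by filter_upwards [hB i] with ω h using abs_le.mp h) (hW i).aemeasurable
          refine this.trans (le_of_eq (by ring))
      _ = n * B^2 := by simp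
  have hm : ∫ ω, (n:ℝ)⁻¹ * (∑ i, W i) ω ∂P = e := by
    rw [integral_const_mul]
    simp only [Finset.sum_apply]
    rw [integral_finsetSum _ (fun i _ => (hL i).integrable (by norm_num))]
    simp [he]
    field_simp
  have := aux_abs P (fun ω => (n:ℝ)⁻¹ * (∑ i, W i) ω) (hLS.const_mul _)
  rw [hm, variance_const_mul] at this
  simp only [Finset.sum_apply] at this
  refine this.trans ?_
  rw [show B / Real.sqrt n = Real.sqrt (B^2 / n) by
    rw [Real.sqrt_div (sq_nonneg B), Real.sqrt_sq hB0]]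
  apply Real.sqrt_le_sqrt
  calc ((n:ℝ)⁻¹)^2 * variance (∑ i, W i) P ≤ ((n:ℝ)⁻¹)^2 * (n * B^2) := by gcongr
    _ = B^2 / n := by field_simp

lemma aux_mu {Ω 𝓧 : Type*} [MeasurableSpace Ω] [MeasurableSpace 𝓧]
    (P : Measure Ω) [IsProbabilityMeasure P]
    (Y : Ω → ℝ) (X : Ω → 𝓧) (hY : Measurable Y) (hX : Measurable X)
    (g : 𝓧 → ℝ) (hg : Measurable g) (C : ℝ) (hC : ∀ x, |g x| ≤ C) (t : ℝ) :
    Integrable (fun ω => if t ≤ Y ω then Real.exp (g (X ω)) else 0) P := by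
  apply Integrable.of_bound (C := Real.exp C)
  · apply Measurable.aestronglyMeasurable
    exact Measurable.ite (measurableSet_le measurable_const hY)
      (Real.measurable_exp.comp (hg.comp hX)) measurable_const
  · refine Filter.Eventually.of_forall fun ω => ?_
    have := (abs_le.mp (hC (X ω))).2
    split_ifs
    · simpa using this
    · simpa using (Real.exp_pos C).le

lemma aux_pos {Ω 𝓧 : Type*} [MeasurableSpace Ω] [MeasurableSpace 𝓧]
    (P : Measure Ω) [IsProbabilityMeasure P]
    (Y : Ω → ℝ) (X : Ω → 𝓧) (hY : Measurable Y) (hX : Measurable X) (τ : ℝ)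
    (hpr : 0 < (P {ω | τ ≤ Y ω}).toReal)
    (g : 𝓧 → ℝ) (hg : Measurable g) (C : ℝ) (hC : ∀ x, |g x| ≤ C) (t : ℝ) (ht : t ≤ τ) :
    (P {ω | τ ≤ Y ω}).toReal * Real.exp (-C) ≤
      ∫ ω, (if t ≤ Y ω then Real.exp (g (X ω)) else 0) ∂P := by
  have hs : MeasurableSet {ω | τ ≤ Y ω} := measurableSet_le measurable_const hY
  have : ∫ ω, Set.indicator {ω | τ ≤ Y ω} (fun _ => Real.exp (-C)) ω ∂P =
      (P {ω | τ ≤ Y ω}).toReal * Real.exp (-C) := by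
    rw [integral_indicator_const _ hs]; rfl
  rw [← this]
  apply integral_mono ((integrable_const _).indicator hs) (aux_mu P Y X hY hX g hg C hC t)
  intro ω
  have := (abs_le.mp (hC (X ω))).1
  by_cases h : τ ≤ Y ω
  · simp [Set.indicator, h, ht.trans h, this]
  · simp only [Set.indicator, Set.mem_setOf_eq, h, if_false]
    split_ifs <;> positivity

lemma aux_le {Ω 𝓧 : Type*} [MeasurableSpace Ω] [MeasurableSpace 𝓧]
    (P : Measure Ω) [IsProbabilityMeasure P]
    (Y : Ω → ℝ) (X : Ω → 𝓧) (hY : Measurable Y) (hX : Measurable X) (τ : ℝ)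
    (hpr : 0 < (P {ω | τ ≤ Y ω}).toReal)
    (g h : 𝓧 → ℝ) (hg : Measurable g) (hh : Measurable h)
    (C C' : ℝ) (hC : ∀ x, |g x| ≤ C) (hC' : ∀ x, |h x| ≤ C')
    (c : ℝ) (hc : ∀ x, |g x - h x| ≤ c) (t : ℝ) (ht : t ≤ τ) :
    Real.log (∫ ω, (if t ≤ Y ω then Real.exp (g (X ω)) else 0) ∂P) -
      Real.log (∫ ω, (if t ≤ Y ω then Real.exp (h (X ω)) else 0) ∂P) ≤ c := by
  have p1 := aux_pos P Y X hY hX τ hpr g hg C hC t ht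
  have p2 := aux_pos P Y X hY hX τ hpr h hh C' hC' t ht
  have q1 := lt_of_lt_of_le (by positivity) p1
  have q2 := lt_of_lt_of_le (by positivity) p2
  have : ∫ ω, (if t ≤ Y ω then Real.exp (g (X ω)) else 0) ∂P ≤
      Real.exp c * ∫ ω, (if t ≤ Y ω then Real.exp (h (X ω)) else 0) ∂P := by
    rw [← integral_const_mul]
    apply integral_mono (aux_mu P Y X hY hX g hg C hC t)
      ((aux_mu P Y X hY hX h hh C' hC' t).const_mul _)
    intro ω
    have := (abs_le.mp (hc (X ω))).2
    simp only
    split_ifs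
    · rw [← Real.exp_add]
      apply Real.exp_le_exp.mpr; linarith
    · simp
  have := Real.log_le_log q1 this
  rw [Real.log_mul (Real.exp_pos c).ne' q2.ne', Real.log_exp] at this
  linarith

theorem lasso_cox_lemma_3_1
    (Ω : Type u) [MeasurableSpace Ω] (𝓧 : Type v) [MeasurableSpace 𝓧] [Nonempty 𝓧]
    (P : Measure Ω) [IsProbabilityMeasure P]
    (n m : ℕ) (hn : 0 < n) (hm : 1 ≤ m)
    (τ : ℝ) (hτ : 0 < τ)
    (Y : Ω → ℝ) (Δ : Ω → ℝ) (X : Ω → 𝓧)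
    (hYmeas : Measurable Y) (hΔmeas : Measurable Δ) (hXmeas : Measurable X)
    (hYrange : ∀ ω, Y ω ∈ Set.Icc 0 τ) (hΔrange : ∀ ω, Δ ω = 0 ∨ Δ ω = 1)
    (pr : ℝ) (hprdef : pr = (P {ω | τ ≤ Y ω}).toReal) (hprpos : 0 < pr)
    (Yi : Fin n → Ω → ℝ) (Δi : Fin n → Ω → ℝ) (Xi : Fin n → Ω → 𝓧)
    (hsamplemeas : ∀ i, Measurable (fun ω => (Yi i ω, Δi i ω, Xi i ω)))
    (hindep : iIndepFun (fun i ω => (Yi i ω, Δi i ω, Xi i ω)) P)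
    (hident : ∀ i, IdentDistrib (fun ω => (Yi i ω, Δi i ω, Xi i ω)) (fun ω => (Y ω, Δ ω, X ω)) P P)
    (ψ : Fin m → 𝓧 → ℝ)
    (hψmeas : ∀ k, Measurable (ψ k))
    (hψbdd : ∀ k, BddAbove (Set.range fun x => |ψ k x|))
    (σ : Fin m → ℝ)
    (hσdef : ∀ k, σ k = Real.sqrt (∫ ω, (ψ k (X ω))^2 ∂P))
    (hσpos : ∀ k, 0 < σ k)
    (Km : ℝ) (hKm : Km = ⨆ k, (⨆ x, |ψ k x|) / σ k)
    (Θ : Set (Fin m → ℝ)) (hΘconv : Convex ℝ Θ) (hΘne : Θ.Nonempty)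
    (Lm : ℝ) (hLm : Lm = ⨆ θ : Θ, ∑ k, |(θ : Fin m → ℝ) k|)
    (hLbdd : BddAbove (Set.range fun θ : Θ => ∑ k, |(θ : Fin m → ℝ) k|))
    (fθ : (Fin m → ℝ) → 𝓧 → ℝ) (hfθ : ∀ θ x, fθ θ x = ∑ k, θ k * ψ k x)
    (Inorm : (Fin m → ℝ) → ℝ) (hInorm : ∀ θ, Inorm θ = ∑ k, σ k * |θ k|)
    (μ : (𝓧 → ℝ) → ℝ → ℝ)
    (hμ : ∀ g t, μ g t = ∫ ω, (if t ≤ Y ω then Real.exp (g (X ω)) else 0) ∂P)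
    (γ : (Fin m → ℝ) → 𝓧 → ℝ → ℝ → ℝ)
    (hγ : ∀ θ x y dl, γ θ x y dl = -(fθ θ x - Real.log (μ (fθ θ) y)) * dl)
    (lExp : (Fin m → ℝ) → ℝ)
    (hlExp : ∀ θ, lExp θ = ∫ ω, γ θ (X ω) (Y ω) (Δ ω) ∂P)
    (ltil : (Fin m → ℝ) → Ω → ℝ)
    (hltil : ∀ θ ω, ltil θ ω = (n:ℝ)⁻¹ * ∑ i, γ θ (Xi i ω) (Yi i ω) (Δi i ω))
    (an abar : ℝ)
    (han : an = Real.sqrt (2 * Km^2 * Real.log (2*m) / n) + Km * Real.log (2*m) / n)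
    (habar : abar = 4 * an)
    (θstar : Fin m → ℝ) (hθstarΘ : θstar ∈ Θ)
    (Z : (Fin m → ℝ) → Ω → ℝ)
    (hZ : ∀ θ ω, Z θ ω = |(ltil θ ω - lExp θ) - (ltil θstar ω - lExp θstar)|)
    :
    ∀ M : ℝ, 0 < M → ∀ θ ∈ Θ, Inorm (θ - θstar) ≤ M →
      (∫ ω, Z θ ω ∂P) ≤ abar * M := by
  intro M hM θ hθ hI
  subst hprdef
  have hn' : (0:ℝ) < n := by exact_mod_cast hn
  have hfm : ∀ θ, Measurable (fθ θ) := fun θ => by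
    have : fθ θ = fun x => ∑ k, θ k * ψ k x := funext (hfθ θ)
    rw [this]
    exact Finset.measurable_fun_sum _ (fun k _ => (hψmeas k).const_mul _)
  have hψK : ∀ k x, |ψ k x| ≤ σ k * Km := by
    intro k x
    have h1 : |ψ k x| ≤ ⨆ x, |ψ k x| := le_ciSup (hψbdd k) x
    have h2 : (⨆ x, |ψ k x|) / σ k ≤ Km := by
      rw [hKm]
      exact le_ciSup (f := fun k => (⨆ x, |ψ k x|) / σ k) (Set.finite_range _).bddAbove k
    rw [div_le_iff₀ (hσpos k)] at h2
    linarith [mul_comm Km (σ k)]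
  have hK0 : 0 ≤ Km := by
    obtain ⟨x⟩ := ‹Nonempty 𝓧›
    have h := (abs_nonneg _).trans (hψK ⟨0, hm⟩ x)
    exact nonneg_of_mul_nonneg_right h (hσpos _)
  have hfb : ∀ θ x, |fθ θ x| ≤ Inorm θ * Km := by
    intro θ x
    rw [hfθ, hInorm, Finset.sum_mul]
    refine (Finset.abs_sum_le_sum_abs _ _).trans (Finset.sum_le_sum fun k _ => ?_)
    rw [abs_mul]
    calc |θ k| * |ψ k x| ≤ |θ k| * (σ k * Km) := by gcongr; exact hψK k x
      _ = _ := by ring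
  have hfsub : ∀ θ η x, fθ θ x - fθ η x = fθ (θ - η) x := by
    intro θ η x
    simp only [hfθ, ← Finset.sum_sub_distrib, Pi.sub_apply, sub_mul]
  have hlog : ∀ θ η t, t ≤ τ →
      |Real.log (μ (fθ θ) t) - Real.log (μ (fθ η) t)| ≤ Inorm (θ - η) * Km := by
    intro θ η t ht
    have hc : ∀ x, |fθ θ x - fθ η x| ≤ Inorm (θ - η) * Km := fun x => by
      rw [hfsub]; exact hfb _ x
    rw [hμ, hμ, abs_le]
    constructor
    · have := aux_le P Y X hYmeas hXmeas τ hprpos (fθ η) (fθ θ) (hfm η) (hfm θ) _ _ (hfb η) (hfb θ)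
        _ (fun x => by rw [abs_sub_comm]; exact hc x) t ht
      linarith
    · exact aux_le P Y X hYmeas hXmeas τ hprpos (fθ θ) (fθ η) (hfm θ) (hfm η) _ _ (hfb θ) (hfb η)
        _ hc t ht
  have hμm : ∀ θ, Measurable (μ (fθ θ)) := by
    intro θ
    apply Antitone.measurable
    intro s t hst
    rw [hμ, hμ]
    apply integral_mono (aux_mu P Y X hYmeas hXmeas _ (hfm θ) _ (hfb θ) t)
      (aux_mu P Y X hYmeas hXmeas _ (hfm θ) _ (hfb θ) s)
    intro ω
    by_cases h : t ≤ Y ω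
    · simp [h, hst.trans h]
    · simp only [h, if_false]
      split_ifs <;> positivity
  have hγm : ∀ θ, Measurable (fun p : ℝ × ℝ × 𝓧 => γ θ p.2.2 p.1 p.2.1) := by
    intro θ
    simp only [hγ]
    have h1 := (hfm θ).comp (measurable_snd.comp measurable_snd : Measurable fun p : ℝ × ℝ × 𝓧 => p.2.2)
    have h2 := Real.measurable_log.comp ((hμm θ).comp (measurable_fst : Measurable fun p : ℝ × ℝ × 𝓧 => p.1))
    have h3 : Measurable fun p : ℝ × ℝ × 𝓧 => p.2.1 := measurable_fst.comp measurable_snd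
    exact (h1.sub h2).neg.mul h3
  have hfull : Measurable (fun ω => (Y ω, Δ ω, X ω)) := hYmeas.prodMk (hΔmeas.prodMk hXmeas)
  have hγb : ∀ θ η x t d, t ≤ τ → (d = 0 ∨ d = 1) →
      |γ θ x t d - γ η x t d| ≤ 2 * (Inorm (θ - η) * Km) := by
    intro θ η x t d ht hd
    have h1 := hlog θ η t ht
    have h2 := hfb (θ - η) x
    rw [← hfsub] at h2
    have h0 := (abs_nonneg _).trans h1
    rw [hγ, hγ]
    rcases hd with rfl | rfl
    · simp only [mul_zero, sub_self, abs_zero]; linarith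
    · rw [abs_le] at *
      constructor <;> linarith [h1.1, h1.2, h2.1, h2.2]
  have hμ0 : ∀ η : Fin m → ℝ, Integrable (fun ω => γ η (X ω) (Y ω) (Δ ω)) P := by
    intro η
    have hb0 : ∀ t, t ≤ τ → |Real.log (μ (fθ η) t)| ≤
        Inorm η * Km + |Real.log ((P {ω | τ ≤ Y ω}).toReal * Real.exp (-(Inorm η * Km)))| := by
      intro t ht
      have p1 := aux_pos P Y X hYmeas hXmeas τ hprpos (fθ η) (hfm η) _ (hfb η) t ht
      have hq : 0 < (P {ω | τ ≤ Y ω}).toReal * Real.exp (-(Inorm η * Km)) := by positivity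
      have p2 : μ (fθ η) t ≤ Real.exp (Inorm η * Km) := by
        rw [hμ]
        have := integral_mono (aux_mu P Y X hYmeas hXmeas _ (hfm η) _ (hfb η) t)
          (integrable_const (Real.exp (Inorm η * Km))) (μ := P) (by
            intro ω
            have := (abs_le.mp (hfb η (X ω))).2
            simp only
            split_ifs
            · exact Real.exp_le_exp.mpr this
            · positivity)
        simpa using this
      rw [← hμ] at p1
      have r1 := Real.log_le_log hq p1
      have r2 := Real.log_le_log (hq.trans_le p1) p2
      rw [Real.log_exp] at r2
      have h0 : 0 ≤ Inorm η * Km := by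
        obtain ⟨x⟩ := ‹Nonempty 𝓧›
        exact (abs_nonneg _).trans (hfb η x)
      have := neg_abs_le (Real.log ((P {ω | τ ≤ Y ω}).toReal * Real.exp (-(Inorm η * Km))))
      have := abs_nonneg (Real.log ((P {ω | τ ≤ Y ω}).toReal * Real.exp (-(Inorm η * Km))))
      rw [abs_le]
      constructor <;> linarith
    apply Integrable.of_bound (C := Inorm η * Km + (Inorm η * Km +
      |Real.log ((P {ω | τ ≤ Y ω}).toReal * Real.exp (-(Inorm η * Km)))|))
      ((hγm η).comp hfull).aestronglyMeasurable
    refine Filter.Eventually.of_forall fun ω => ?_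
    have h1 := hb0 (Y ω) (hYrange ω).2
    have h2 := hfb η (X ω)
    have h3 := (abs_nonneg _).trans h1
    have h4 := (abs_nonneg _).trans h2
    simp only [Function.comp_apply, Real.norm_eq_abs, hγ]
    rcases hΔrange ω with h | h <;> rw [h]
    · simp only [mul_zero, abs_zero]; linarith
    · rw [mul_one, abs_neg]
      exact (abs_sub _ _).trans (add_le_add h2 h1)
  let D : ℝ × ℝ × 𝓧 → ℝ := fun p => γ θ p.2.2 p.1 p.2.1 - γ θstar p.2.2 p.1 p.2.1
  have hD : Measurable D := (hγm θ).sub (hγm θstar)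
  have hB0 : 0 ≤ 2 * (M * Km) := by positivity
  have key := aux_mean P n hn (fun i ω => D (Yi i ω, Δi i ω, Xi i ω))
    (fun i => hD.comp (hsamplemeas i))
    (hindep.comp (fun _ => D) (fun _ => hD)) (2 * (M * Km)) (lExp θ - lExp θstar) hB0 (by
      intro i

      refine (hident i).symm.ae_snd (p := fun p => |D p| ≤ 2 * (M * Km))
        (measurableSet_le hD.abs measurable_const) ?_
      refine Filter.Eventually.of_forall fun ω => ?_
      refine (hγb θ θstar (X ω) (Y ω) (Δ ω) (hYrange ω).2 (hΔrange ω)).trans ?_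
      gcongr) (by
      intro i
      rw [hlExp, hlExp, ← integral_sub (hμ0 θ) (hμ0 θstar)]
      exact ((hident i).comp hD).integral_eq)
  have hZe : ∫ ω, Z θ ω ∂P = ∫ ω, |(n:ℝ)⁻¹ * ∑ i, D (Yi i ω, Δi i ω, Xi i ω) -
      (lExp θ - lExp θstar)| ∂P := by
    congr 1
    funext ω
    rw [hZ, hltil, hltil]
    simp only [D, Finset.sum_sub_distrib]
    congr 1
    ring
  rw [hZe]
  refine key.trans ?_
  have hm' : (1:ℝ) ≤ m := by exact_mod_cast hm
  have hl : (1/2 : ℝ) ≤ Real.log (2 * m) := by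
    have h1 : Real.log 2 ≤ Real.log (2 * m) := Real.log_le_log (by norm_num) (by linarith)
    linarith [Real.log_two_gt_d9]
  have h1 : Km / Real.sqrt n ≤ Real.sqrt (2 * Km^2 * Real.log (2*m) / n) := by
    rw [show Km / Real.sqrt n = Real.sqrt (Km^2 / n) by
      rw [Real.sqrt_div (sq_nonneg _), Real.sqrt_sq hK0]]
    apply Real.sqrt_le_sqrt
    gcongr
    nlinarith [sq_nonneg Km]
  have h2 : 0 ≤ Km * Real.log (2*m) / n := by positivity
  have h3 : 0 ≤ Km / Real.sqrt n := by positivity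
  rw [habar, han]
  calc 2 * (M * Km) / Real.sqrt n = (2 * (Km / Real.sqrt n)) * M := by ring
    _ ≤ _ := by
      apply mul_le_mul_of_nonneg_right _ hM.le
      linarith
end

section
/- Let ε_1, …, ε_n be a Rademacher sequence (i.i.d. uniform on {−1, +1}) independent of the data. For every M > 0 and every θ, θ* ∈ Θ with I(θ − θ*) ≤ M, E[ | (1/n) Σ_{i=1}^n ε_i Δ_i ( log μ(Y_i; f_θ) − log μ(Y_i; f_{θ*}) ) | ] ≤ a_n · M, where a_n := √(2 K_m² log(2m)/n) + K_m log(2m)/n. -/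
open MeasureTheory ProbabilityTheory Real Finset

universe u v


theorem aux_log_bound (a b B : ℝ) (hB : 0 ≤ B) (ha : 0 ≤ a) (hb : 0 ≤ b)
    (h1 : a ≤ Real.exp B * b) (h2 : b ≤ Real.exp B * a) :
    |Real.log a - Real.log b| ≤ B := by
  rcases ha.eq_or_lt with h | h
  · subst h
    have : b = 0 := by linarith
    subst this; simpa using hB
  · have hb' : 0 < b := by
      by_contra hc
      have : b = 0 := by linarith
      subst this; simp at h1; linarith
    have e1 := Real.log_le_log h h1
    have e2 := Real.log_le_log hb' h2
    rw [Real.log_mul (Real.exp_pos _).ne' hb'.ne', Real.log_exp] at e1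
    rw [Real.log_mul (Real.exp_pos _).ne' h.ne', Real.log_exp] at e2
    rw [abs_le]; constructor <;> linarith

theorem aux_rad {Ω : Type*} [MeasurableSpace Ω] (P : Measure Ω) [IsProbabilityMeasure P]
    (n : ℕ) (hn : 0 < n) (ε c : Fin n → Ω → ℝ) (B : ℝ) (hB : 0 ≤ B)
    (hεmeas : ∀ i, Measurable (ε i)) (hcmeas : ∀ i, Measurable (c i))
    (hεrange : ∀ i ω, ε i ω = 1 ∨ ε i ω = -1)
    (hεmean : ∀ i, ∫ ω, ε i ω ∂P = 0)
    (hεindep : iIndepFun (fun i ω => ε i ω) P)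
    (hεc : IndepFun (fun ω i => ε i ω) (fun ω i => c i ω) P)
    (hc : ∀ i, ∀ᵐ ω ∂P, |c i ω| ≤ B) :
    ∫ ω, |(n:ℝ)⁻¹ * ∑ i, ε i ω * c i ω| ∂P ≤ B / Real.sqrt n := by
  have hn' : (0:ℝ) < n := by exact_mod_cast hn
  set S : Ω → ℝ := fun ω => ∑ i, ε i ω * c i ω with hS
  have hεabs : ∀ i ω, |ε i ω| = 1 := by
    intro i ω; rcases hεrange i ω with h | h <;> simp [h]
  have hSmeas : Measurable S := by
    apply Finset.measurable_sum; intro i _; exact (hεmeas i).mul (hcmeas i)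
  have hall : ∀ᵐ ω ∂P, ∀ i, |c i ω| ≤ B := ae_all_iff.2 hc
  have hSb : ∀ᵐ ω ∂P, |S ω| ≤ n * B := by
    filter_upwards [hall] with ω h
    calc |S ω| ≤ ∑ i, |ε i ω * c i ω| := Finset.abs_sum_le_sum_abs _ _
      _ ≤ ∑ _i : Fin n, B := by
        apply Finset.sum_le_sum; intro i _; rw [abs_mul, hεabs, one_mul]; exact h i
      _ = n * B := by simp
  have hSint : Integrable (fun ω => |S ω|) P := by
    apply Integrable.of_bound hSmeas.abs.aestronglyMeasurable (n*B)
    filter_upwards [hSb] with ω h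
    simpa using h
  have hS2int : Integrable (fun ω => (S ω)^2) P := by
    apply Integrable.of_bound (hSmeas.pow_const 2).aestronglyMeasurable ((n*B)^2)
    filter_upwards [hSb] with ω h
    rw [Real.norm_eq_abs, abs_pow]
    exact pow_le_pow_left₀ (abs_nonneg _) h 2
  have hterm : ∀ i j, Integrable (fun ω => (ε i ω * ε j ω) * (c i ω * c j ω)) P := by
    intro i j
    apply Integrable.of_bound (C := B*B)
    · exact (((hεmeas i).mul (hεmeas j)).mul ((hcmeas i).mul (hcmeas j))).aestronglyMeasurable
    · filter_upwards [hall] with ω h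
      rw [Real.norm_eq_abs, abs_mul, abs_mul, abs_mul, hεabs, hεabs, one_mul, one_mul]
      exact mul_le_mul (h i) (h j) (abs_nonneg _) hB
  have hoff : ∀ i j, i ≠ j → ∫ ω, (ε i ω * ε j ω) * (c i ω * c j ω) ∂P = 0 := by
    intro i j hij
    have h1 : IndepFun (fun ω => ε i ω * ε j ω) (fun ω => c i ω * c j ω) P :=
      hεc.comp (φ := fun e : Fin n → ℝ => e i * e j) (ψ := fun e : Fin n → ℝ => e i * e j)
        (by fun_prop) (by fun_prop)
    rw [h1.integral_fun_mul_eq_mul_integral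
      ((hεmeas i).mul (hεmeas j)).aestronglyMeasurable
      ((hcmeas i).mul (hcmeas j)).aestronglyMeasurable]
    rw [(hεindep.indepFun hij).integral_fun_mul_eq_mul_integral
      (hεmeas i).aestronglyMeasurable (hεmeas j).aestronglyMeasurable, hεmean i]
    simp
  have hdiag : ∀ i, ∫ ω, (ε i ω * ε i ω) * (c i ω * c i ω) ∂P ≤ B^2 := by
    intro i
    have : ∫ ω, (ε i ω * ε i ω) * (c i ω * c i ω) ∂P ≤ ∫ _ω, B^2 ∂P := by
      apply integral_mono_ae (hterm i i) (integrable_const _)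
      filter_upwards [hc i] with ω h
      have e1 : ε i ω * ε i ω = 1 := by rcases hεrange i ω with h | h <;> simp [h]
      have := sq_le_sq' (by linarith [abs_le.1 h]) (abs_le.1 h).2
      simp only [e1]; linarith
    simpa using this
  have hS2 : ∫ ω, (S ω)^2 ∂P ≤ n * B^2 := by
    have e : ∀ ω, (S ω)^2 = ∑ i, ∑ j, (ε i ω * ε j ω) * (c i ω * c j ω) := by
      intro ω
      rw [hS, sq, Finset.sum_mul_sum]
      refine Finset.sum_congr rfl fun i _ => Finset.sum_congr rfl fun j _ => by ring
    simp_rw [e]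
    rw [integral_finsetSum _ (fun i _ => integrable_finsetSum _ (fun j _ => hterm i j))]
    calc _ ≤ ∑ _i : Fin n, B^2 := by
          apply Finset.sum_le_sum; intro i _
          rw [integral_finsetSum _ (fun j _ => hterm i j)]
          rw [Finset.sum_eq_single i (fun j _ hj => hoff i j hj.symm) (by simp)]
          exact hdiag i
      _ = n * B^2 := by simp
  set s := ∫ ω, |S ω| ∂P with hs
  have hvar : s^2 ≤ ∫ ω, (S ω)^2 ∂P := by
    have h0 : 0 ≤ ∫ ω, (|S ω| - s)^2 ∂P := integral_nonneg fun ω => sq_nonneg _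
    have e : ∀ ω, (|S ω| - s)^2 = ((S ω)^2 - (2*s) * |S ω|) + s^2 := by
      intro ω; rw [← sq_abs (S ω)]; ring
    simp_rw [e] at h0
    have hi : Integrable (fun ω => (S ω)^2 - (2*s) * |S ω|) P := hS2int.sub (hSint.const_mul _)
    rw [integral_add hi (integrable_const _),
      integral_sub hS2int (hSint.const_mul _), integral_const_mul, ← hs] at h0
    simp at h0
    nlinarith
  have hsle : s ≤ Real.sqrt n * B := by
    refine (abs_le_of_sq_le_sq' ?_ (by positivity)).2
    rw [mul_pow, Real.sq_sqrt hn'.le]; linarith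
  have e : ∀ ω, |(n:ℝ)⁻¹ * ∑ i, ε i ω * c i ω| = (n:ℝ)⁻¹ * |S ω| := by
    intro ω; rw [abs_mul, abs_of_pos (inv_pos.2 hn')]
  simp_rw [e]
  rw [integral_const_mul, ← hs]
  calc (n:ℝ)⁻¹ * s ≤ (n:ℝ)⁻¹ * (Real.sqrt n * B) := by gcongr
    _ = B / Real.sqrt n := by
      have := Real.sqrt_pos.2 hn'
      have h2 := Real.sq_sqrt hn'.le
      field_simp
      rw [h2]

theorem lasso_cox_rademacher_log_mu_bound
    (Ω : Type u) [MeasurableSpace Ω] (𝓧 : Type v) [MeasurableSpace 𝓧] [Nonempty 𝓧]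
    (P : Measure Ω) [IsProbabilityMeasure P]
    (n m : ℕ) (hn : 0 < n) (hm : 1 ≤ m)
    (τ : ℝ) (hτ : 0 < τ)
    (Y : Ω → ℝ) (Δ : Ω → ℝ) (X : Ω → 𝓧)
    (hYmeas : Measurable Y) (hΔmeas : Measurable Δ) (hXmeas : Measurable X)
    (hYrange : ∀ ω, Y ω ∈ Set.Icc 0 τ) (hΔrange : ∀ ω, Δ ω = 0 ∨ Δ ω = 1)
    (pr : ℝ) (hprdef : pr = (P {ω | τ ≤ Y ω}).toReal) (hprpos : 0 < pr)
    (Yi : Fin n → Ω → ℝ) (Δi : Fin n → Ω → ℝ) (Xi : Fin n → Ω → 𝓧)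
    (hsamplemeas : ∀ i, Measurable (fun ω => (Yi i ω, Δi i ω, Xi i ω)))
    (hindep : iIndepFun (fun i ω => (Yi i ω, Δi i ω, Xi i ω)) P)
    (hident : ∀ i, IdentDistrib (fun ω => (Yi i ω, Δi i ω, Xi i ω)) (fun ω => (Y ω, Δ ω, X ω)) P P)
    (ψ : Fin m → 𝓧 → ℝ)
    (hψmeas : ∀ k, Measurable (ψ k))
    (hψbdd : ∀ k, BddAbove (Set.range fun x => |ψ k x|))
    (σ : Fin m → ℝ)
    (hσdef : ∀ k, σ k = Real.sqrt (∫ ω, (ψ k (X ω))^2 ∂P))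
    (hσpos : ∀ k, 0 < σ k)
    (Km : ℝ) (hKm : Km = ⨆ k, (⨆ x, |ψ k x|) / σ k)
    (Θ : Set (Fin m → ℝ)) (hΘconv : Convex ℝ Θ) (hΘne : Θ.Nonempty)
    (Lm : ℝ) (hLm : Lm = ⨆ θ : Θ, ∑ k, |(θ : Fin m → ℝ) k|)
    (hLbdd : BddAbove (Set.range fun θ : Θ => ∑ k, |(θ : Fin m → ℝ) k|))
    (fθ : (Fin m → ℝ) → 𝓧 → ℝ) (hfθ : ∀ θ x, fθ θ x = ∑ k, θ k * ψ k x)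
    (Inorm : (Fin m → ℝ) → ℝ) (hInorm : ∀ θ, Inorm θ = ∑ k, σ k * |θ k|)
    (μ : (𝓧 → ℝ) → ℝ → ℝ)
    (hμ : ∀ g t, μ g t = ∫ ω, (if t ≤ Y ω then Real.exp (g (X ω)) else 0) ∂P)
    (ε : Fin n → Ω → ℝ)
    (hεmeas : ∀ i, Measurable (ε i))
    (hεrange : ∀ i ω, ε i ω = 1 ∨ ε i ω = -1)
    (hεdist : ∀ i, P {ω | ε i ω = 1} = 1/2 ∧ P {ω | ε i ω = -1} = 1/2)
    (hεindep : iIndepFun (fun i ω => ε i ω) P)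
    (hεdata : IndepFun (fun ω i => ε i ω) (fun ω i => (Yi i ω, Δi i ω, Xi i ω)) P)
    (an : ℝ)
    (han : an = Real.sqrt (2 * Km^2 * Real.log (2*m) / n) + Km * Real.log (2*m) / n)
    :
    ∀ M : ℝ, 0 < M → ∀ θ ∈ Θ, ∀ θs ∈ Θ, Inorm (θ - θs) ≤ M →
      (∫ ω, |(n:ℝ)⁻¹ * ∑ i, ε i ω * Δi i ω *
          (Real.log (μ (fθ θ) (Yi i ω)) - Real.log (μ (fθ θs) (Yi i ω)))| ∂P) ≤ an * M := by
  intro M hM θ hθ θs hθs hI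
  have hKk : ∀ k, (⨆ x, |ψ k x|) / σ k ≤ Km := fun k => by
    rw [hKm]
    exact le_ciSup (f := fun k => (⨆ x, |ψ k x|) / σ k) (Set.finite_range _).bddAbove k
  have hψb : ∀ k x, |ψ k x| ≤ Km * σ k := fun k x => by
    have h1 := hKk k
    rw [div_le_iff₀ (hσpos k)] at h1
    exact (le_ciSup (hψbdd k) x).trans h1
  have hKm0 : 0 ≤ Km := by
    obtain ⟨x⟩ := ‹Nonempty 𝓧›
    have h1 := (abs_nonneg _).trans (hψb ⟨0, hm⟩ x)
    exact nonneg_of_mul_nonneg_left h1 (hσpos _)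
  have hfb : ∀ θ x, |fθ θ x| ≤ Km * Inorm θ := fun θ x => by
    rw [hfθ, hInorm, Finset.mul_sum]
    refine (Finset.abs_sum_le_sum_abs _ _).trans (Finset.sum_le_sum fun k _ => ?_)
    rw [abs_mul]
    calc |θ k| * |ψ k x| ≤ |θ k| * (Km * σ k) := by gcongr; exact hψb k x
      _ = _ := by ring
  have hfmeas : ∀ θ, Measurable (fθ θ) := fun θ => by
    have : fθ θ = fun x => ∑ k, θ k * ψ k x := funext (hfθ θ)
    rw [this]
    exact Finset.measurable_sum _ fun k _ => (hψmeas k).const_mul _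
  have hsub : ∀ x, |fθ θ x - fθ θs x| ≤ Km * M := fun x => by
    have : fθ θ x - fθ θs x = fθ (θ - θs) x := by
      simp only [hfθ, ← Finset.sum_sub_distrib, Pi.sub_apply, sub_mul]
    rw [this]
    exact (hfb _ x).trans (by gcongr)
  have hint : ∀ θ t, Integrable (fun ω => if t ≤ Y ω then Real.exp (fθ θ (X ω)) else 0) P := by
    intro θ t
    apply Integrable.of_bound (C := Real.exp (Km * Inorm θ))
    · exact (Measurable.ite (measurableSet_le measurable_const hYmeas)
        ((hfmeas θ).comp hXmeas).exp measurable_const).aestronglyMeasurable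
    · refine Filter.Eventually.of_forall fun ω => ?_
      split_ifs
      · rw [Real.norm_eq_abs, abs_of_pos (Real.exp_pos _), Real.exp_le_exp]
        exact (abs_le.1 (hfb θ _)).2
      · simpa using (Real.exp_pos _).le
  have hμ0 : ∀ θ t, 0 ≤ μ (fθ θ) t := fun θ t => by
    rw [hμ]
    refine integral_nonneg fun ω => ?_
    dsimp only
    split_ifs
    · exact (Real.exp_pos _).le
    · exact le_rfl
  have hμmeas : ∀ θ, Measurable (μ (fθ θ)) := fun θ => by
    apply Antitone.measurable
    intro s t hst
    rw [hμ, hμ]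
    refine integral_mono (hint θ t) (hint θ s) fun ω => ?_
    dsimp only
    split_ifs with h1 h2
    · exact le_rfl
    · exact absurd (hst.trans h1) h2
    · exact (Real.exp_pos _).le
    · exact le_rfl
  have hcmp : ∀ θ θ' : Fin m → ℝ, (∀ x, |fθ θ x - fθ θ' x| ≤ Km * M) → ∀ t,
      μ (fθ θ) t ≤ Real.exp (Km * M) * μ (fθ θ') t := by
    intro θ θ' h t
    rw [hμ, hμ, ← integral_const_mul]
    refine integral_mono (hint θ t) ((hint θ' t).const_mul _) fun ω => ?_
    dsimp only
    split_ifs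
    · rw [← Real.exp_add, Real.exp_le_exp]
      linarith [(abs_le.1 (h (X ω))).2]
    · simp
  have hB : 0 ≤ Km * M := by positivity
  have hlog : ∀ t, |Real.log (μ (fθ θ) t) - Real.log (μ (fθ θs) t)| ≤ Km * M := fun t =>
    aux_log_bound _ _ _ hB (hμ0 _ _) (hμ0 _ _) (hcmp _ _ hsub t)
      (hcmp _ _ (fun x => by rw [abs_sub_comm]; exact hsub x) t)
  let G : ℝ × ℝ × 𝓧 → ℝ := fun p =>
    p.2.1 * (Real.log (μ (fθ θ) p.1) - Real.log (μ (fθ θs) p.1))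
  have hG : Measurable G :=
    (measurable_fst.comp measurable_snd).mul
      ((((hμmeas θ).comp measurable_fst).log).sub (((hμmeas θs).comp measurable_fst).log))
  have hmean : ∀ i, ∫ ω, ε i ω ∂P = 0 := by
    intro i
    have hms : MeasurableSet {ω | ε i ω = 1} := hεmeas i (measurableSet_singleton 1)
    have e : ∀ ω, ε i ω = 2 * ({ω | ε i ω = 1}.indicator (fun _ => (1:ℝ)) ω) - 1 := by
      intro ω
      rcases hεrange i ω with h | h
      · rw [Set.indicator_of_mem (by exact h), h]; norm_num
      · rw [Set.indicator_of_notMem (by intro h'; simp only [Set.mem_ofPred_eq] at h'; linarith), h]; norm_num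
    have hi : Integrable ({ω | ε i ω = 1}.indicator (fun _ => (1:ℝ))) P :=
      (integrable_const _).indicator hms
    rw [integral_congr_ae (Filter.Eventually.of_forall e),
      integral_sub (hi.const_mul 2) (integrable_const _), integral_const_mul,
      integral_indicator_const _ hms, measureReal_def, (hεdist i).1]
    simp
  have hΔae : ∀ i, ∀ᵐ ω ∂P, Δi i ω = 0 ∨ Δi i ω = 1 := by
    intro i
    have hms : MeasurableSet {p : ℝ × ℝ × 𝓧 | p.2.1 = 0 ∨ p.2.1 = 1} :=
      (measurable_fst.comp measurable_snd) 
        ((measurableSet_singleton (0:ℝ)).union (measurableSet_singleton (1:ℝ)))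
    exact (hident i).symm.ae_snd (p := fun p : ℝ × ℝ × 𝓧 => p.2.1 = 0 ∨ p.2.1 = 1) hms
      (Filter.Eventually.of_forall hΔrange)
  have key := aux_rad P n hn ε (fun i ω => G (Yi i ω, Δi i ω, Xi i ω)) (Km * M) hB hεmeas
    (fun i => hG.comp (hsamplemeas i)) hεrange hmean hεindep
    (hεdata.comp (φ := id) (ψ := fun (d : Fin n → ℝ × ℝ × 𝓧) i => G (d i)) measurable_id
      (measurable_pi_lambda _ fun i => hG.comp (measurable_pi_apply i)))
    (fun i => by
      filter_upwards [hΔae i] with ω h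
      rcases h with h | h
      · simpa [G, h] using hB
      · simpa [G, h] using hlog (Yi i ω))
  simp only [G, ← mul_assoc] at key
  refine key.trans ?_
  have hn' : (0:ℝ) < n := by exact_mod_cast hn
  have hm' : (1:ℝ) ≤ m := by exact_mod_cast hm
  have hl : 1/2 ≤ Real.log (2*m) := by
    have h1 := Real.log_le_log (by norm_num : (0:ℝ) < 2) (by linarith : (2:ℝ) ≤ 2*m)
    have := Real.log_two_gt_d9
    linarith
  have h1 : Km / Real.sqrt n ≤ Real.sqrt (2 * Km^2 * Real.log (2*m) / n) := by
    apply Real.le_sqrt_of_sq_le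
    rw [div_pow, Real.sq_sqrt hn'.le]
    gcongr
    nlinarith [sq_nonneg Km]
  have h2 : 0 ≤ Km * Real.log (2*m) / n := by positivity
  calc Km * M / Real.sqrt n = Km / Real.sqrt n * M := by ring
    _ ≤ an * M := by
      gcongr
      rw [han]; linarith
end

section
/- For all M > 0, all r₁ > 0, and all θ ∈ Θ with I(θ − θ*) ≤ M, P( Z_θ ≥ λ̄^A_{n,0}(r₁) · M ) ≤ exp(−n ā_n² r₁²), where λ̄^A_{n,0}(r₁) := ā_n (1 + 2 r₁ √(2(K_m² + ā_n K_m)) + 4 r₁² ā_n K_m / 3). (Corollary 3.1) -/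
open MeasureTheory ProbabilityTheory Real Finset

universe u v

lemma hoeffding_two {Ω : Type u} [MeasurableSpace Ω] {E : Type v} [MeasurableSpace E]
    (P : Measure Ω) [IsProbabilityMeasure P] (n : ℕ) (hn : 0 < n)
    (W : Ω → E) (Wi : Fin n → Ω → E) (hWi : ∀ i, Measurable (Wi i))
    (hindep : iIndepFun Wi P) (hident : ∀ i, IdentDistrib (Wi i) W P P)
    (g : E → ℝ) (hg : Measurable g) (B : ℝ) (hB : 0 < B)
    (hbd : ∀ᵐ ω ∂P, |g (W ω)| ≤ B) (t : ℝ) (ht : 0 ≤ t) :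
    (P {ω | t ≤ |(n:ℝ)⁻¹ * ∑ i, g (Wi i ω) - ∫ ω, g (W ω) ∂P|}).toReal
      ≤ 2 * Real.exp (-(n * t^2 / (2 * B^2))) := by
  have hn' : (0:ℝ) < n := by exact_mod_cast hn
  set m := ∫ ω, g (W ω) ∂P with hm
  have hbdi : ∀ i, ∀ᵐ ω ∂P, g (Wi i ω) ∈ Set.Icc (-B) B := by
    intro i
    have hS : MeasurableSet {x : E | g x ∈ Set.Icc (-B) B} := hg measurableSet_Icc
    exact (hident i).symm.ae_snd hS (hbd.mono fun ω h => abs_le.1 h)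
  have hint : ∀ i, ∫ ω, g (Wi i ω) ∂P = m := fun i => ((hident i).comp hg).integral_eq
  have hsub : ∀ i, HasSubgaussianMGF (fun ω => g (Wi i ω) - m) ((‖B - (-B)‖₊ / 2) ^ 2) P := by
    intro i
    have := hasSubgaussianMGF_of_mem_Icc (hg.comp (hWi i)).aemeasurable (hbdi i)
    simpa [hint i] using this
  have hind1 : iIndepFun (fun i ω => g (Wi i ω) - m) P :=
    hindep.comp (fun _ x => g x - m) (fun _ => hg.sub_const m)
  have hind2 : iIndepFun (fun i ω => -(g (Wi i ω) - m)) P :=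
    hindep.comp (fun _ x => -(g x - m)) (fun _ => (hg.sub_const m).neg)
  have hnt : 0 ≤ n * t := by positivity
  have e1 := HasSubgaussianMGF.measure_sum_ge_le_of_iIndepFun hind1 (s := Finset.univ)
    (fun i _ => hsub i) hnt
  have e2 := HasSubgaussianMGF.measure_sum_ge_le_of_iIndepFun hind2 (s := Finset.univ)
    (fun i _ => (hsub i).neg) hnt
  have hexp : -(n * t) ^ 2 / (2 * ((∑ i : Fin n, (‖B - (-B)‖₊ / 2) ^ 2 : NNReal) : ℝ))
      = -(n * t^2 / (2 * B^2)) := by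
    have : ‖B - (-B)‖ = 2 * B := by
      rw [Real.norm_eq_abs, abs_of_pos] <;> linarith
    push_cast
    rw [this]
    simp
    field_simp
  rw [hexp] at e1 e2
  have hsum : ∀ ω, (n:ℝ)⁻¹ * ∑ i, g (Wi i ω) - m = (n:ℝ)⁻¹ * ∑ i, (g (Wi i ω) - m) := by
    intro ω
    rw [Finset.sum_sub_distrib]
    simp
    field_simp
  have hsubset : {ω | t ≤ |(n:ℝ)⁻¹ * ∑ i, g (Wi i ω) - m|} ⊆
      {ω | n * t ≤ ∑ i, (g (Wi i ω) - m)} ∪ {ω | n * t ≤ ∑ i, -(g (Wi i ω) - m)} := by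
    intro ω hω
    simp only [Set.mem_ofPred_eq, Set.mem_union] at hω ⊢
    rw [hsum, le_abs] at hω
    rw [Finset.sum_neg_distrib]
    rcases hω with h | h
    · left
      rwa [← div_eq_inv_mul, le_div_iff₀ hn', mul_comm] at h
    · right
      rwa [← mul_neg, ← div_eq_inv_mul, le_div_iff₀ hn', mul_comm] at h
  change P.real _ ≤ _
  calc _ ≤ _ := measureReal_mono hsubset
    _ ≤ _ := measureReal_union_le _ _
    _ ≤ _ := add_le_add e1 e2
    _ = _ := by ring

set_option maxHeartbeats 1000000 in
theorem lasso_cox_corollary_3_1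
    (Ω : Type u) [MeasurableSpace Ω] (𝓧 : Type v) [MeasurableSpace 𝓧] [Nonempty 𝓧]
    (P : Measure Ω) [IsProbabilityMeasure P]
    (n m : ℕ) (hn : 0 < n) (hm : 1 ≤ m)
    (τ : ℝ) (hτ : 0 < τ)
    (Y : Ω → ℝ) (Δ : Ω → ℝ) (X : Ω → 𝓧)
    (hYmeas : Measurable Y) (hΔmeas : Measurable Δ) (hXmeas : Measurable X)
    (hYrange : ∀ ω, Y ω ∈ Set.Icc 0 τ) (hΔrange : ∀ ω, Δ ω = 0 ∨ Δ ω = 1)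
    (pr : ℝ) (hprdef : pr = (P {ω | τ ≤ Y ω}).toReal) (hprpos : 0 < pr)
    (Yi : Fin n → Ω → ℝ) (Δi : Fin n → Ω → ℝ) (Xi : Fin n → Ω → 𝓧)
    (hsamplemeas : ∀ i, Measurable (fun ω => (Yi i ω, Δi i ω, Xi i ω)))
    (hindep : iIndepFun (fun i ω => (Yi i ω, Δi i ω, Xi i ω)) P)
    (hident : ∀ i, IdentDistrib (fun ω => (Yi i ω, Δi i ω, Xi i ω)) (fun ω => (Y ω, Δ ω, X ω)) P P)
    (ψ : Fin m → 𝓧 → ℝ)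
    (hψmeas : ∀ k, Measurable (ψ k))
    (hψbdd : ∀ k, BddAbove (Set.range fun x => |ψ k x|))
    (σ : Fin m → ℝ)
    (hσdef : ∀ k, σ k = Real.sqrt (∫ ω, (ψ k (X ω))^2 ∂P))
    (hσpos : ∀ k, 0 < σ k)
    (Km : ℝ) (hKm : Km = ⨆ k, (⨆ x, |ψ k x|) / σ k)
    (Θ : Set (Fin m → ℝ)) (hΘconv : Convex ℝ Θ) (hΘne : Θ.Nonempty)
    (Lm : ℝ) (hLm : Lm = ⨆ θ : Θ, ∑ k, |(θ : Fin m → ℝ) k|)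
    (hLbdd : BddAbove (Set.range fun θ : Θ => ∑ k, |(θ : Fin m → ℝ) k|))
    (fθ : (Fin m → ℝ) → 𝓧 → ℝ) (hfθ : ∀ θ x, fθ θ x = ∑ k, θ k * ψ k x)
    (Inorm : (Fin m → ℝ) → ℝ) (hInorm : ∀ θ, Inorm θ = ∑ k, σ k * |θ k|)
    (μ : (𝓧 → ℝ) → ℝ → ℝ)
    (hμ : ∀ g t, μ g t = ∫ ω, (if t ≤ Y ω then Real.exp (g (X ω)) else 0) ∂P)
    (γ : (Fin m → ℝ) → 𝓧 → ℝ → ℝ → ℝ)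
    (hγ : ∀ θ x y dl, γ θ x y dl = -(fθ θ x - Real.log (μ (fθ θ) y)) * dl)
    (lExp : (Fin m → ℝ) → ℝ)
    (hlExp : ∀ θ, lExp θ = ∫ ω, γ θ (X ω) (Y ω) (Δ ω) ∂P)
    (ltil : (Fin m → ℝ) → Ω → ℝ)
    (hltil : ∀ θ ω, ltil θ ω = (n:ℝ)⁻¹ * ∑ i, γ θ (Xi i ω) (Yi i ω) (Δi i ω))
    (an abar : ℝ)
    (han : an = Real.sqrt (2 * Km^2 * Real.log (2*m) / n) + Km * Real.log (2*m) / n)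
    (habar : abar = 4 * an)
    (θstar : Fin m → ℝ) (hθstarΘ : θstar ∈ Θ)
    (Z : (Fin m → ℝ) → Ω → ℝ)
    (hZ : ∀ θ ω, Z θ ω = |(ltil θ ω - lExp θ) - (ltil θstar ω - lExp θstar)|)
    :
    ∀ M : ℝ, 0 < M → ∀ r₁ : ℝ, 0 < r₁ → ∀ θ ∈ Θ, Inorm (θ - θstar) ≤ M →
      (P {ω | abar * (1 + 2 * r₁ * Real.sqrt (2 * (Km^2 + abar * Km)) + 4 * r₁^2 * abar * Km / 3) * M
          ≤ Z θ ω}).toReal ≤ Real.exp (-(n * abar^2 * r₁^2)) := by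
  intro M hM r hr θ hθ hI
  have hn' : (0:ℝ) < n := by exact_mod_cast hn
  have hm' : (1:ℝ) ≤ m := by exact_mod_cast hm
  -- sup bounds
  have hsup : ∀ k x, |ψ k x| ≤ Km * σ k := by
    intro k x
    have h1 : |ψ k x| ≤ ⨆ x, |ψ k x| := le_ciSup (hψbdd k) x
    have h2 : (⨆ x, |ψ k x|) / σ k ≤ Km := by
      rw [hKm]
      exact le_ciSup (f := fun k => (⨆ x, |ψ k x|) / σ k) (Set.finite_range _).bddAbove k
    rw [div_le_iff₀ (hσpos k)] at h2
    linarith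
  have hKpos : 0 < Km := by
    by_contra hneg
    have k : Fin m := ⟨0, hm⟩
    have h0 : ∀ x, ψ k x = 0 := by
      intro x
      have h1 := hsup k x
      have h2 : Km * σ k ≤ 0 := mul_nonpos_of_nonpos_of_nonneg (not_lt.1 hneg) (hσpos k).le
      exact abs_eq_zero.1 (le_antisymm (h1.trans h2) (abs_nonneg _))
    have := hσpos k
    rw [hσdef k] at this
    simp [h0] at this
  have hfmeas : ∀ ϑ, Measurable (fθ ϑ) := by
    intro ϑ
    have : fθ ϑ = fun x => ∑ k, ϑ k * ψ k x := funext (hfθ ϑ)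
    rw [this]
    exact Finset.measurable_sum _ fun k _ => (hψmeas k).const_mul _
  have hfdiff : ∀ ϑ ϑ' x, |fθ ϑ x - fθ ϑ' x| ≤ Km * Inorm (ϑ - ϑ') := by
    intro ϑ ϑ' x
    rw [hfθ, hfθ, ← Finset.sum_sub_distrib, hInorm, Finset.mul_sum]
    refine (Finset.abs_sum_le_sum_abs _ _).trans (Finset.sum_le_sum fun k _ => ?_)
    rw [← sub_mul, abs_mul, Pi.sub_apply]
    calc _ ≤ |ϑ k - ϑ' k| * (Km * σ k) := by gcongr; exact hsup k x
      _ = _ := by ring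
  have hfbd : ∀ ϑ x, |fθ ϑ x| ≤ Km * Inorm ϑ := by
    intro ϑ x
    have := hfdiff ϑ 0 x
    have h0 : fθ 0 x = 0 := by simp [hfθ]
    simpa [h0] using this
  have hintg : ∀ ϑ t, Integrable (fun ω => if t ≤ Y ω then Real.exp (fθ ϑ (X ω)) else 0) P := by
    intro ϑ t
    refine Integrable.of_bound (C := Real.exp (Km * Inorm ϑ)) ?_ ?_
    · exact (Measurable.ite (measurableSet_le measurable_const hYmeas)
        (Real.measurable_exp.comp ((hfmeas ϑ).comp hXmeas)) measurable_const).aestronglyMeasurable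
    · refine Filter.Eventually.of_forall fun ω => ?_
      have := (abs_le.1 (hfbd ϑ (X ω))).2
      split_ifs
      · rw [Real.norm_eq_abs, abs_of_pos (Real.exp_pos _)]
        exact Real.exp_le_exp.2 this
      · simp [(Real.exp_pos _).le]
  have hanti : ∀ ϑ, Antitone (μ (fθ ϑ)) := by
    intro ϑ s t hst
    rw [hμ, hμ]
    refine integral_mono (hintg ϑ t) (hintg ϑ s) fun ω => ?_
    dsimp only
    have := (Real.exp_pos (fθ ϑ (X ω))).le
    split_ifs <;> first | exact le_rfl | exact this | (exfalso; linarith)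
  have hnn : ∀ ϑ t, 0 ≤ μ (fθ ϑ) t := by
    intro ϑ t
    rw [hμ]
    refine integral_nonneg fun ω => ?_
    dsimp only
    split_ifs
    · exact (Real.exp_pos _).le
    · exact le_rfl
  have hμpos : ∀ ϑ, 0 < μ (fθ ϑ) τ := by
    intro ϑ
    rw [hμ]
    have hS : MeasurableSet {ω | τ ≤ Y ω} := measurableSet_le measurable_const hYmeas
    have h1 : ∫ ω, (Set.indicator {ω | τ ≤ Y ω} (fun _ => Real.exp (-(Km * Inorm ϑ)))) ω ∂P
        ≤ ∫ ω, (if τ ≤ Y ω then Real.exp (fθ ϑ (X ω)) else 0) ∂P := by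
      refine integral_mono ((integrable_const _).indicator hS) (hintg ϑ τ) fun ω => ?_
      have := (abs_le.1 (hfbd ϑ (X ω))).1
      by_cases h : τ ≤ Y ω
      · simpa [Set.indicator, h] using this
      · simp [Set.indicator, h]
    rw [integral_indicator_const _ hS] at h1
    refine lt_of_lt_of_le ?_ h1
    rw [hprdef] at hprpos
    exact mul_pos hprpos (Real.exp_pos _)
  have hratio : ∀ ϑ ϑ' c t, (∀ x, |fθ ϑ x - fθ ϑ' x| ≤ c) →
      μ (fθ ϑ) t ≤ Real.exp c * μ (fθ ϑ') t := by
    intro ϑ ϑ' c t hc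
    rw [hμ, hμ, ← integral_const_mul]
    refine integral_mono (hintg ϑ t) ((hintg ϑ' t).const_mul _) fun ω => ?_
    dsimp only
    split_ifs
    · rw [← Real.exp_add]
      exact Real.exp_le_exp.2 (by linarith [(abs_le.1 (hc (X ω))).2])
    · simp
  have hlogdiff1 : ∀ ϑ ϑ' c t, 0 ≤ c → (∀ x, |fθ ϑ x - fθ ϑ' x| ≤ c) →
      Real.log (μ (fθ ϑ) t) - Real.log (μ (fθ ϑ') t) ≤ c := by
    intro ϑ ϑ' c t hc0 hc
    have hc' : ∀ x, |fθ ϑ' x - fθ ϑ x| ≤ c := fun x => by rw [abs_sub_comm]; exact hc x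
    have h1 := hratio ϑ ϑ' c t hc
    have h2 := hratio ϑ' ϑ c t hc'
    rcases (hnn ϑ t).eq_or_lt with h | h
    · rw [← h, mul_zero] at h2
      have h3 : μ (fθ ϑ') t = 0 := le_antisymm h2 (hnn _ _)
      rw [← h, h3]
      simpa using hc0
    · have h3 : 0 < μ (fθ ϑ') t := by
        by_contra hcon
        have : μ (fθ ϑ') t = 0 := le_antisymm (not_lt.1 hcon) (hnn _ _)
        rw [this, mul_zero] at h1
        linarith
      have h4 := Real.log_le_log h h1
      rw [Real.log_mul (Real.exp_pos _).ne' h3.ne', Real.log_exp] at h4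
      linarith
  have hc : ∀ x, |fθ θ x - fθ θstar x| ≤ Km * M := fun x =>
    (hfdiff _ _ x).trans (mul_le_mul_of_nonneg_left hI hKpos.le)
  have hc' : ∀ x, |fθ θstar x - fθ θ x| ≤ Km * M := fun x => by rw [abs_sub_comm]; exact hc x
  have hKM : 0 < Km * M := mul_pos hKpos hM
  -- the loss as a function on the sample space
  have hGmeas : ∀ ϑ, Measurable (fun p : ℝ × ℝ × 𝓧 => γ ϑ p.2.2 p.1 p.2.1) := by
    intro ϑ
    simp only [hγ]
    exact (((hfmeas ϑ).comp measurable_snd.snd).sub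
      (Real.measurable_log.comp ((hanti ϑ).measurable.comp measurable_fst))).neg.mul
      measurable_snd.fst
  have hGint : ∀ ϑ, Integrable (fun ω => γ ϑ (X ω) (Y ω) (Δ ω)) P := by
    intro ϑ
    have hmeas : Measurable (fun ω => γ ϑ (X ω) (Y ω) (Δ ω)) :=
      (hGmeas ϑ).comp (hYmeas.prodMk (hΔmeas.prodMk hXmeas))
    refine Integrable.of_bound (C := Km * Inorm ϑ + (|Real.log (μ (fθ ϑ) τ)|
      + |Real.log (μ (fθ ϑ) 0)|)) hmeas.aestronglyMeasurable
      (Filter.Eventually.of_forall fun ω => ?_)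
    have hy := hYrange ω
    have g1 := Real.log_le_log (hμpos ϑ) (hanti ϑ hy.2)
    have g2 := Real.log_le_log ((hμpos ϑ).trans_le (hanti ϑ hy.2)) (hanti ϑ hy.1)
    have g3 := abs_le.1 (hfbd ϑ (X ω))
    have g4 := neg_abs_le (Real.log (μ (fθ ϑ) τ))
    have g5 := le_abs_self (Real.log (μ (fθ ϑ) 0))
    have g6 := abs_nonneg (Real.log (μ (fθ ϑ) τ))
    have g7 := abs_nonneg (Real.log (μ (fθ ϑ) 0))
    rw [hγ, Real.norm_eq_abs]
    rcases hΔrange ω with h | h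
    · rw [h]; simp; linarith
    · rw [h, mul_one, abs_le]; constructor <;> linarith
  have hH := hoeffding_two P n hn (fun ω => (Y ω, Δ ω, X ω)) (fun i ω => (Yi i ω, Δi i ω, Xi i ω))
    hsamplemeas hindep hident
    (fun p : ℝ × ℝ × 𝓧 => γ θ p.2.2 p.1 p.2.1 - γ θstar p.2.2 p.1 p.2.1)
    ((hGmeas θ).sub (hGmeas θstar)) (2 * (Km * M)) (by positivity)
    (Filter.Eventually.of_forall fun ω => by
      dsimp only
      have g1 := abs_le.1 (hc (X ω))
      have g2 := hlogdiff1 θ θstar _ (Y ω) hKM.le hc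
      have g3 := hlogdiff1 θstar θ _ (Y ω) hKM.le hc'
      rw [hγ, hγ]
      rcases hΔrange ω with h | h
      · rw [h]; simp; linarith
      · rw [h, mul_one, mul_one, abs_le]; constructor <;> linarith)
  have hlog : Real.log 2 ≤ Real.log (2 * m) := Real.log_le_log (by norm_num) (by linarith)
  have hlog2 : 0 < Real.log 2 := Real.log_pos (by norm_num)
  set L := Real.log (2 * m) with hL
  have hLpos : 0 < L := hlog2.trans_le hlog
  have han2 : Real.sqrt (2 * Km^2 * L / n) ≤ an := by
    rw [han]
    have : 0 ≤ Km * L / n := by positivity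
    linarith
  have hanpos : 0 < an := lt_of_lt_of_le (Real.sqrt_pos.2 (by positivity)) han2
  have hansq : 2 * Km^2 * L / n ≤ an^2 := by
    rw [← Real.sq_sqrt (show 0 ≤ 2 * Km^2 * L / n by positivity)]
    exact pow_le_pow_left₀ (Real.sqrt_nonneg _) han2 2
  have habpos : 0 < abar := by rw [habar]; positivity
  set lam := abar * (1 + 2 * r * Real.sqrt (2 * (Km^2 + abar * Km)) + 4 * r^2 * abar * Km / 3)
    with hlam
  have hlampos : 0 ≤ lam := by positivity
  have hsetEq : {ω | lam * M ≤ Z θ ω} = {ω | lam * M ≤ |(n:ℝ)⁻¹ * ∑ i,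
      (γ θ (Xi i ω) (Yi i ω) (Δi i ω) - γ θstar (Xi i ω) (Yi i ω) (Δi i ω))
      - ∫ ω, (γ θ (X ω) (Y ω) (Δ ω) - γ θstar (X ω) (Y ω) (Δ ω)) ∂P|} := by
    ext ω
    have : Z θ ω = |(n:ℝ)⁻¹ * ∑ i,
      (γ θ (Xi i ω) (Yi i ω) (Δi i ω) - γ θstar (Xi i ω) (Yi i ω) (Δi i ω))
      - ∫ ω, (γ θ (X ω) (Y ω) (Δ ω) - γ θstar (X ω) (Y ω) (Δ ω)) ∂P| := by
      rw [hZ, integral_sub (hGint θ) (hGint θstar), hltil, hltil, hlExp, hlExp,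
        Finset.sum_sub_distrib]
      congr 1
      ring
    change lam * M ≤ Z θ ω ↔ lam * M ≤ _
    rw [this]
  rw [hsetEq]
  refine (hH (lam * M) (by positivity)).trans ?_
  -- numeric part
  have hsq : lam^2 ≥ abar^2 + 8 * Km^2 * abar^2 * r^2 := by
    have hs0 := Real.sqrt_nonneg (2 * (Km^2 + abar * Km))
    have hs2 := Real.sq_sqrt (show 0 ≤ 2 * (Km^2 + abar * Km) by positivity)
    set s := Real.sqrt (2 * (Km^2 + abar * Km))
    have hq : 0 ≤ 4 * r^2 * abar * Km / 3 := by positivity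
    have h1 : 1 + 2 * r * s ≤ 1 + 2 * r * s + 4 * r^2 * abar * Km / 3 := by linarith
    have h2 : (1 + 2 * r * s)^2 ≤ (1 + 2 * r * s + 4 * r^2 * abar * Km / 3)^2 :=
      pow_le_pow_left₀ (by positivity) h1 2
    have h3 : 1 + 8 * Km^2 * r^2 ≤ (1 + 2 * r * s)^2 := by
      have : (1 + 2 * r * s)^2 = 1 + 4 * r * s + 4 * r^2 * s^2 := by ring
      rw [this, hs2]
      have h4 : 0 ≤ 4 * r * s := by positivity
      have h5 : 0 ≤ r^2 * (abar * Km) := by positivity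
      linarith
    rw [hlam, mul_pow]
    linarith [mul_le_mul_of_nonneg_left (h3.trans h2) (sq_nonneg abar)]
  have key : Real.log 2 + n * abar^2 * r^2 ≤ n * (lam * M)^2 / (2 * (2 * (Km * M))^2) := by
    have e : n * (lam * M)^2 / (2 * (2 * (Km * M))^2) = n * lam^2 / (8 * Km^2) := by
      field_simp; ring
    rw [e, le_div_iff₀ (by positivity)]
    have h1 : 2 * Km^2 * L ≤ an^2 * n := by rwa [div_le_iff₀ hn'] at hansq
    have h2 : n * (abar^2 + 8 * Km^2 * abar^2 * r^2) ≤ n * lam^2 :=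
      mul_le_mul_of_nonneg_left hsq hn'.le
    have h3 : abar^2 = 16 * an^2 := by rw [habar]; ring
    have h4 : Km^2 * Real.log 2 ≤ Km^2 * L := mul_le_mul_of_nonneg_left hlog (sq_nonneg _)
    have h5 : 0 ≤ Km^2 * L := by positivity
    have h6 : n * abar^2 = 16 * (an^2 * n) := by rw [h3]; ring
    linarith
  calc 2 * Real.exp (-(n * (lam * M)^2 / (2 * (2 * (Km * M))^2)))
      = Real.exp (Real.log 2 + -(n * (lam * M)^2 / (2 * (2 * (Km * M))^2))) := by
        rw [Real.exp_add, Real.exp_log (by norm_num)]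
    _ ≤ _ := Real.exp_le_exp.2 (by linarith)
end

section
/- There exists a constant W > 0 (not depending on n, m, the distribution of (Y, Δ, X), or θ) such that for all θ ∈ Θ and all r₁ > 0, P( sup_{0 ≤ t ≤ τ} | (1/n) Σ_{i=1}^n 1(Y_i ≥ t) e^{f_θ(X_i)} − μ(t; f_θ) | ≥ U_m ā_n r₁ ) ≤ (W²/5) exp(−n ā_n² r₁²). (Lemma 3.3) -/
open MeasureTheory ProbabilityTheory Real Finset

universe u v

def lcSgn (b : Bool) : ℝ := if b then 1 else -1

lemma lc_rad_sorted (n : ℕ) : ∀ (a y : Fin n → ℝ), Antitone y → ∀ s0 M : ℝ, |s0| ≤ M →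
    ∃ B : (Fin n → Bool) → ℝ, (∀ ε, M ≤ B ε) ∧
      (∀ ε t, |s0 + ∑ i, lcSgn (ε i) * (if t ≤ y i then a i else 0)| ≤ B ε) ∧
      ∑ ε, (B ε)^2 ≤ 2^n * (4 * s0^2 - 4 * M * |s0| + 2 * M^2 + 4 * ∑ i, (a i)^2) := by
  induction n with
  | zero =>
    intro a y _ s0 M h
    refine ⟨fun _ => M, fun _ => le_rfl, fun ε t => by simpa using h, ?_⟩
    simp
    nlinarith [sq_nonneg (2 * |s0| - M), sq_abs s0]
  | succ n ih =>
    intro a y hy s0 M h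
    have H : ∀ b : Bool, ∃ B : (Fin n → Bool) → ℝ, 
      (∀ ε, max M |s0 + lcSgn b * a 0| ≤ B ε) ∧
      (∀ ε t, |s0 + lcSgn b * a 0 + ∑ i : Fin n, lcSgn (ε i) * (if t ≤ y i.succ then a i.succ else 0)| ≤ B ε) ∧
      ∑ ε, (B ε)^2 ≤ 2^n * (4 * (s0 + lcSgn b * a 0)^2 - 4 * (max M |s0 + lcSgn b * a 0|) * |s0 + lcSgn b * a 0| + 2 * (max M |s0 + lcSgn b * a 0|)^2 + 4 * ∑ i : Fin n, (a i.succ)^2) := fun b =>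
      ih (fun i => a i.succ) (fun i => y i.succ) (fun i j hij => hy (Fin.succ_le_succ_iff.2 hij)) _ _ (le_max_right _ _)
    choose B hB1 hB2 hB3 using H
    refine ⟨fun ε => B (ε 0) (fun i => ε i.succ), fun ε => (le_max_left _ _).trans (hB1 _ _), ?_, ?_⟩
    · intro ε t
      by_cases ht : t ≤ y 0
      · have := hB2 (ε 0) (fun i => ε i.succ) t
        rw [Fin.sum_univ_succ, if_pos ht, ← add_assoc]
        exact this
      · have : ∀ i, ¬ t ≤ y i := fun i hi => ht (hi.trans (hy (Fin.zero_le i)))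
        simp only [this, if_false, mul_zero, Finset.sum_const_zero, add_zero]
        exact h.trans ((le_max_left _ _).trans (hB1 _ _))
    · rw [← (Fin.consEquiv (fun _ : Fin (n+1) => Bool)).sum_comp, Fintype.sum_prod_type]
      simp only [Fin.consEquiv_apply, Fin.cons_zero, Fin.cons_succ, Fintype.sum_bool]
      have key : ∀ s M : ℝ, 4 * s^2 - 4 * (max M |s|) * |s| + 2 * (max M |s|)^2 ≤ 4 * s^2 - 4 * M * |s| + 2 * M^2 := by
        intro s M
        rcases le_total M |s| with h | h
        · rw [max_eq_right h]; nlinarith [sq_nonneg (|s| - M)]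
        · rw [max_eq_left h]
      have h1 := hB3 true
      have h2 := hB3 false
      have k1 := key (s0 + lcSgn true * a 0) M
      have k2 := key (s0 + lcSgn false * a 0) M
      have hM : 0 ≤ M := (abs_nonneg _).trans h
      have tri : 2 * |s0| ≤ |s0 + lcSgn true * a 0| + |s0 + lcSgn false * a 0| := by
        simp only [lcSgn, if_true]
        calc 2 * |s0| = |(s0 + 1 * a 0) + (s0 + (-1) * a 0)| := by
              rw [show (s0 + 1 * a 0) + (s0 + (-1) * a 0) = 2 * s0 by ring, abs_mul]; simp
          _ ≤ _ := by simpa using abs_add_le (s0 + 1 * a 0) (s0 + (-1) * a 0)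
      have sq : (s0 + lcSgn true * a 0)^2 + (s0 + lcSgn false * a 0)^2 = 2 * s0^2 + 2 * (a 0)^2 := by
        simp [lcSgn]; ring
      rw [Fin.sum_univ_succ, pow_succ]
      have hMt : M * (2 * |s0|) ≤ M * (|s0 + lcSgn true * a 0| + |s0 + lcSgn false * a 0|) := mul_le_mul_of_nonneg_left tri hM
      refine (add_le_add h1 h2).trans ?_
      rw [← mul_add, mul_assoc (2^n : ℝ) 2]
      refine mul_le_mul_of_nonneg_left ?_ (by positivity)
      linarith

lemma lc_rad (n : ℕ) (hn : 0 < n) (a y : Fin n → ℝ) (ha : ∀ i, |a i| ≤ 1) :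
    ∃ B : (Fin n → Bool) → ℝ, 
      (∀ ε t, |∑ i, lcSgn (ε i) * (if t ≤ y i then a i else 0)| ≤ B ε) ∧
      ∑ ε, B ε ≤ 2^n * (2 * √n) := by
  let p : Equiv.Perm (Fin n) := Tuple.sort (fun i => - y i)
  have hp : Antitone (y ∘ p) := by
    intro i j hij
    have := Tuple.monotone_sort (fun i => - y i) hij
    simpa using this
  obtain ⟨B, -, hB, hs⟩ := lc_rad_sorted n (a ∘ p) (y ∘ p) hp 0 0 (by simp)
  refine ⟨fun ε => B (ε ∘ p), fun ε t => ?_, ?_⟩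
  · have := hB (ε ∘ p) t
    rw [zero_add] at this
    rw [← Equiv.sum_comp p]
    exact this
  · have e1 : ∑ ε : Fin n → Bool, B (ε ∘ p) = ∑ ε, B ε :=
      (Equiv.arrowCongr p.symm (Equiv.refl Bool)).sum_comp B
    rw [e1]
    have hn' : 0 < √(n:ℝ) := by positivity
    have hsum : ∑ i, ((a ∘ p) i)^2 ≤ n := by
      calc _ ≤ ∑ i : Fin n, (1:ℝ) := Finset.sum_le_sum fun i _ => by
              have := ha (p i)
              exact (sq_le_one_iff_abs_le_one _).2 this
        _ = n := by simp
    have hpt : ∀ ε, B ε ≤ (B ε)^2 / (4 * √n) + √n := by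
      intro ε
      have : (B ε)^2 / (4 * √n) + √n - B ε = (B ε - 2 * √n)^2 / (4 * √n) := by field_simp; ring
      have : 0 ≤ (B ε - 2 * √n)^2 / (4 * √n) := by positivity
      linarith
    calc ∑ ε, B ε ≤ ∑ ε, ((B ε)^2 / (4 * √n) + √n) := Finset.sum_le_sum fun ε _ => hpt ε
      _ = (∑ ε, (B ε)^2) / (4 * √n) + 2^n * √n := by
          rw [Finset.sum_add_distrib, Finset.sum_div]; simp
      _ ≤ (2^n * (4 * n)) / (4 * √n) + 2^n * √n := by
          gcongr
          refine hs.trans ?_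
          refine mul_le_mul_of_nonneg_left ?_ (by positivity)
          simp only [abs_zero]; linarith
      _ = 2^n * (2 * √n) := by
          have : (n:ℝ) = √n * √n := by simp
          field_simp
          rw [Real.sq_sqrt (by positivity)]; ring

lemma lc_mcd {E : Type*} [MeasurableSpace E] (ν : Measure E) [IsProbabilityMeasure ν] (c : ℝ) (hc : 0 ≤ c) (l : ℝ) (n : ℕ) :
    ∀ (f : (Fin n → E) → ℝ), Measurable f → ∀ C : ℝ, (∀ z, |f z| ≤ C) →
      (∀ z i x, |f (Function.update z i x) - f z| ≤ c) →
      ∫ z, exp (l * (f z - ∫ z', f z' ∂(Measure.pi fun _ => ν))) ∂(Measure.pi fun _ => ν)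
        ≤ exp (n * c^2 * l^2 / 8) := by
  induction n with
  | zero =>
    intro f hf C hC hd
    have : ∀ z, f z = f default := fun z => by congr 1; exact Subsingleton.elim _ _
    simp only [this]
    simp
  | succ n ih =>
    intro f hf C hC hd
    obtain ⟨x0⟩ : Nonempty E := nonempty_of_isProbabilityMeasure ν
    have hmp := (measurePreserving_piFinSuccAbove (fun _ : Fin (n+1) => ν) 0).symm
    have hcons : Measurable (fun p : E × (Fin n → E) => (Fin.cons p.1 p.2 : Fin (n+1) → E)) := by
      have := (MeasurableEquiv.piFinSuccAbove (fun _ : Fin (n+1) => E) 0).symm.measurable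
      simpa [MeasurableEquiv.piFinSuccAbove, Fin.insertNthEquiv] using this
    have hint : ∀ F : (Fin (n+1) → E) → ℝ, Measurable F → (∃ C, ∀ z, |F z| ≤ C) →
        ∫ z, F z ∂(Measure.pi fun _ => ν) = ∫ y, ∫ x, F (Fin.cons x y) ∂ν ∂(Measure.pi fun _ : Fin n => ν) := by
      intro F hF ⟨C, hC⟩
      rw [← hmp.integral_comp']
      rw [integral_prod_symm]
      · simp [MeasurableEquiv.piFinSuccAbove, Fin.insertNthEquiv]
      · refine Integrable.of_bound (C := C) ?_ ?_
        · exact (hF.comp (MeasurableEquiv.measurable _)).aestronglyMeasurable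
        · exact Filter.Eventually.of_forall fun z => hC _
    set g : (Fin n → E) → ℝ := fun y => ∫ x, f (Fin.cons x y) ∂ν with hg
    have hfc : Measurable (fun p : (Fin n → E) × E => f (Fin.cons p.2 p.1)) :=
      hf.comp (hcons.comp measurable_swap)
    have hfy : ∀ y, Measurable (fun x => f (Fin.cons x y)) := fun y => hfc.comp measurable_prodMk_left
    have hfi : ∀ y, Integrable (fun x => f (Fin.cons x y)) ν := fun y =>
      Integrable.of_bound (C := C) (hfy y).aestronglyMeasurable (Filter.Eventually.of_forall fun z => hC _)
    have hgm : Measurable g := (hfc.stronglyMeasurable.integral_prod_right).measurable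
    have hgC : ∀ y, |g y| ≤ C := fun y => by
      have := norm_integral_le_of_norm_le_const (μ := ν) (f := fun x => f (Fin.cons x y)) (C := C)
        (Filter.Eventually.of_forall fun z => hC _)
      simpa using this
    have hgd : ∀ z i x, |g (Function.update z i x) - g z| ≤ c := by
      intro z i x
      simp only [hg]
      rw [← integral_sub (hfi _) (hfi _)]
      have := norm_integral_le_of_norm_le_const (μ := ν) (f := fun x' => f (Fin.cons x' (Function.update z i x)) - f (Fin.cons x' z)) (C := c)
        (Filter.Eventually.of_forall fun x' => by
          rw [Fin.cons_update]; exact hd _ _ _)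
      simpa using this
    have hEf : ∫ z', f z' ∂(Measure.pi fun _ => ν) = ∫ y, g y ∂(Measure.pi fun _ => ν) := 
      hint f hf ⟨C, hC⟩
    rw [hEf]
    set m := ∫ y, g y ∂(Measure.pi fun _ => ν) with hm
    have hbd : ∀ u : ℝ, |u| ≤ C → |rexp (l * (u - m))| ≤ rexp (|l| * (C + |m|)) := by
      intro u hu
      rw [abs_of_pos (exp_pos _)]
      refine exp_le_exp.2 ((le_abs_self _).trans ?_)
      rw [abs_mul]
      gcongr
      exact (abs_sub _ _).trans (by gcongr)
    rw [hint _ (by fun_prop) ⟨_, fun z => hbd _ (hC z)⟩]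
    have hoef : ∀ y, ∫ x, rexp (l * (f (Fin.cons x y) - m)) ∂ν ≤ exp (c^2 * l^2 / 8) * rexp (l * (g y - m)) := by
      intro y
      have hbb : BddBelow (Set.range fun x => f (Fin.cons x y)) :=
        ⟨-C, by rintro _ ⟨x, rfl⟩; exact (abs_le.1 (hC _)).1⟩
      have hsub := hasSubgaussianMGF_of_mem_Icc (μ := ν) (X := fun x => f (Fin.cons x y))
        (a := ⨅ x, f (Fin.cons x y)) (b := (⨅ x, f (Fin.cons x y)) + c) (hfy y).aemeasurable
        (Filter.Eventually.of_forall fun x => ⟨ciInf_le hbb x, by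
          rw [← sub_le_iff_le_add]
          have : Nonempty E := ⟨x0⟩
          refine le_ciInf fun x' => ?_
          have := hd (Fin.cons x' y) 0 x
          rw [Fin.update_cons_zero] at this
          linarith [(abs_le.1 this).2]⟩)
      have := hsub.mgf_le l
      simp only [mgf] at this
      calc ∫ x, rexp (l * (f (Fin.cons x y) - m)) ∂ν 
          = ∫ x, rexp (l * (f (Fin.cons x y) - g y)) * rexp (l * (g y - m)) ∂ν := by
            congr 1; ext x; rw [← exp_add]; congr 1; ring
        _ = (∫ x, rexp (l * (f (Fin.cons x y) - g y)) ∂ν) * rexp (l * (g y - m)) := integral_mul_const _ _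
        _ ≤ _ := by
          gcongr
          refine this.trans (le_of_eq ?_)
          congr 1
          simp [abs_of_nonneg hc]
          ring
    calc _ ≤ ∫ y, exp (c^2 * l^2 / 8) * rexp (l * (g y - m)) ∂(Measure.pi fun _ => ν) := by
          refine integral_mono ?_ ?_ hoef
          · refine Integrable.of_bound (C := rexp (|l| * (C + |m|))) ?_ ?_
            · have : Measurable (fun p : (Fin n → E) × E => rexp (l * (f (Fin.cons p.2 p.1) - m))) := by fun_prop
              exact (this.stronglyMeasurable.integral_prod_right).aestronglyMeasurable
            · refine Filter.Eventually.of_forall fun y => ?_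
              have := norm_integral_le_of_norm_le_const (μ := ν) (f := fun x => rexp (l * (f (Fin.cons x y) - m))) 
                (Filter.Eventually.of_forall fun z => hbd _ (hC _))
              simpa using this
          · refine Integrable.const_mul ?_ _
            refine Integrable.of_bound (C := rexp (|l| * (C + |m|))) ?_ ?_
            · exact Measurable.aestronglyMeasurable (by fun_prop)
            · exact Filter.Eventually.of_forall fun y => hbd _ (hgC y)
      _ = exp (c^2 * l^2 / 8) * ∫ y, rexp (l * (g y - m)) ∂(Measure.pi fun _ => ν) := integral_const_mul _ _
      _ ≤ exp (c^2 * l^2 / 8) * exp (n * c^2 * l^2 / 8) := by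
          gcongr
          exact ih g hgm C hgC hgd
      _ = _ := by rw [← exp_add]; congr 1; push_cast; ring

noncomputable def lcH {E : Type*} (y w : E → ℝ) (t : ℝ) (z : E) : ℝ := if t ≤ y z then w z else 0

lemma lcH_nonneg {E : Type*} {y w : E → ℝ} (hw0 : ∀ z, 0 ≤ w z) (t : ℝ) (z : E) : 0 ≤ lcH y w t z := by
  unfold lcH; split_ifs; exacts [hw0 z, le_rfl]

lemma lcH_le {E : Type*} {y w : E → ℝ} (hw1 : ∀ z, w z ≤ 1) (t : ℝ) (z : E) : lcH y w t z ≤ 1 := by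
  unfold lcH; split_ifs; exacts [hw1 z, zero_le_one]

lemma lcH_meas {E : Type*} [MeasurableSpace E] {y w : E → ℝ} (hy : Measurable y) (hw : Measurable w) (t : ℝ) :
    Measurable (lcH y w t) :=
  Measurable.ite (measurableSet_le measurable_const hy) hw measurable_const

noncomputable def lcG {E : Type*} {n : ℕ} (y w : E → ℝ) (p : (Fin n → E) × (Fin n → E)) : ℝ :=
  ⨆ q : ℚ, |∑ i, (lcH y w q (p.1 i) - lcH y w q (p.2 i))|

noncomputable def lcF {E : Type*} [MeasurableSpace E] (ν : Measure E) {n : ℕ} (y w : E → ℝ) (z : Fin n → E) : ℝ :=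
  ⨆ q : ℚ, |(n:ℝ)⁻¹ * ∑ i, lcH y w q (z i) - ∫ x, lcH y w q x ∂ν|

section
set_option linter.unusedSectionVars false
variable {E : Type*} [MeasurableSpace E] {y w : E → ℝ}

lemma lcG_term_le (hw0 : ∀ z, 0 ≤ w z) (hw1 : ∀ z, w z ≤ 1) {n : ℕ}
    (p : (Fin n → E) × (Fin n → E)) (t : ℝ) :
    |∑ i, (lcH y w t (p.1 i) - lcH y w t (p.2 i))| ≤ n := by
  calc _ ≤ ∑ i, |lcH y w t (p.1 i) - lcH y w t (p.2 i)| := Finset.abs_sum_le_sum_abs _ _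
    _ ≤ ∑ i : Fin n, (1:ℝ) := Finset.sum_le_sum fun i _ => by
        rw [abs_le]
        constructor <;> linarith [lcH_nonneg hw0 (y := y) t (p.1 i), lcH_nonneg hw0 (y := y) t (p.2 i),
          lcH_le hw1 (y := y) t (p.1 i), lcH_le hw1 (y := y) t (p.2 i)]
    _ = n := by simp

lemma lcG_le (hw0 : ∀ z, 0 ≤ w z) (hw1 : ∀ z, w z ≤ 1) {n : ℕ}
    (p : (Fin n → E) × (Fin n → E)) : |lcG y w p| ≤ n := by
  unfold lcG
  rw [abs_of_nonneg (Real.iSup_nonneg fun _ => abs_nonneg _)]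
  exact ciSup_le fun q => lcG_term_le hw0 hw1 p q

lemma lc_le_G (hw0 : ∀ z, 0 ≤ w z) (hw1 : ∀ z, w z ≤ 1) {n : ℕ}
    (p : (Fin n → E) × (Fin n → E)) (q : ℚ) :
    |∑ i, (lcH y w q (p.1 i) - lcH y w q (p.2 i))| ≤ lcG y w p :=
  le_ciSup (f := fun q : ℚ => |∑ i, (lcH y w q (p.1 i) - lcH y w q (p.2 i))|)
    ⟨n, by rintro _ ⟨q, rfl⟩; exact lcG_term_le hw0 hw1 p q⟩ q

lemma lcG_meas (hy : Measurable y) (hw : Measurable w) {n : ℕ} :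
    Measurable (lcG y w : (Fin n → E) × (Fin n → E) → ℝ) := by
  unfold lcG
  refine Measurable.iSup fun q => ?_
  have := lcH_meas hy hw q
  fun_prop

lemma lc_int (ν : Measure E) [IsProbabilityMeasure ν] (hy : Measurable y) (hw : Measurable w)
    (hw0 : ∀ z, 0 ≤ w z) (hw1 : ∀ z, w z ≤ 1) (t : ℝ) : Integrable (lcH y w t) ν :=
  Integrable.of_bound (C := 1) (lcH_meas hy hw t).aestronglyMeasurable
    (Filter.Eventually.of_forall fun z => by
      rw [Real.norm_eq_abs, abs_of_nonneg (lcH_nonneg hw0 t z)]; exact lcH_le hw1 t z)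

lemma lcF_term_le (ν : Measure E) [IsProbabilityMeasure ν] (hy : Measurable y) (hw : Measurable w)
    (hw0 : ∀ z, 0 ≤ w z) (hw1 : ∀ z, w z ≤ 1) {n : ℕ} (hn : 0 < n) (z : Fin n → E) (t : ℝ) :
    |(n:ℝ)⁻¹ * ∑ i, lcH y w t (z i) - ∫ x, lcH y w t x ∂ν| ≤ 1 := by
  have h1 : 0 ≤ ∫ x, lcH y w t x ∂ν := integral_nonneg fun x => lcH_nonneg hw0 t x
  have h2 : ∫ x, lcH y w t x ∂ν ≤ 1 := by
    have := integral_mono (lc_int ν hy hw hw0 hw1 t) (integrable_const (1:ℝ)) fun x => lcH_le hw1 t x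
    simpa using this
  have h3 : 0 ≤ (n:ℝ)⁻¹ * ∑ i, lcH y w t (z i) := by
    have := Finset.sum_nonneg (s := Finset.univ) fun i _ => lcH_nonneg hw0 (y := y) t (z i)
    positivity
  have h4 : (n:ℝ)⁻¹ * ∑ i, lcH y w t (z i) ≤ 1 := by
    have : ∑ i, lcH y w t (z i) ≤ ∑ i : Fin n, (1:ℝ) := Finset.sum_le_sum fun i _ => lcH_le hw1 t (z i)
    simp at this
    rw [inv_mul_le_iff₀ (by positivity)]; simpa using this
  rw [abs_le]; constructor <;> linarith

lemma lc_le_F (ν : Measure E) [IsProbabilityMeasure ν] (hy : Measurable y) (hw : Measurable w)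
    (hw0 : ∀ z, 0 ≤ w z) (hw1 : ∀ z, w z ≤ 1) {n : ℕ} (hn : 0 < n) (z : Fin n → E) (q : ℚ) :
    |(n:ℝ)⁻¹ * ∑ i, lcH y w q (z i) - ∫ x, lcH y w q x ∂ν| ≤ lcF ν y w z :=
  le_ciSup (f := fun q : ℚ => |(n:ℝ)⁻¹ * ∑ i, lcH y w q (z i) - ∫ x, lcH y w q x ∂ν|)
    ⟨1, by rintro _ ⟨q, rfl⟩; exact lcF_term_le ν hy hw hw0 hw1 hn z q⟩ q

lemma lcF_le (ν : Measure E) [IsProbabilityMeasure ν] (hy : Measurable y) (hw : Measurable w)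
    (hw0 : ∀ z, 0 ≤ w z) (hw1 : ∀ z, w z ≤ 1) {n : ℕ} (hn : 0 < n) (z : Fin n → E) :
    |lcF ν y w z| ≤ 1 := by
  unfold lcF
  rw [abs_of_nonneg (Real.iSup_nonneg fun _ => abs_nonneg _)]
  exact ciSup_le fun q => lcF_term_le ν hy hw hw0 hw1 hn z q

lemma lcF_meas (ν : Measure E) (hy : Measurable y) (hw : Measurable w) {n : ℕ} :
    Measurable (lcF ν y w : (Fin n → E) → ℝ) := by
  unfold lcF
  refine Measurable.iSup fun q => ?_
  have := lcH_meas hy hw q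
  fun_prop

lemma lcF_diff (ν : Measure E) [IsProbabilityMeasure ν] (hy : Measurable y) (hw : Measurable w)
    (hw0 : ∀ z, 0 ≤ w z) (hw1 : ∀ z, w z ≤ 1) {n : ℕ} (hn : 0 < n) (z : Fin n → E) (i : Fin n) (x : E) :
    |lcF ν y w (Function.update z i x) - lcF ν y w z| ≤ (n:ℝ)⁻¹ := by
  have key : ∀ z z' : Fin n → E, (∀ j, j ≠ i → z j = z' j) → lcF ν y w z ≤ lcF ν y w z' + (n:ℝ)⁻¹ := by
    intro z z' h
    refine ciSup_le fun q => ?_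
    have h1 := lc_le_F ν hy hw hw0 hw1 hn z' q
    have h2 : |∑ j, lcH y w q (z j) - ∑ j, lcH y w q (z' j)| ≤ 1 := by
      rw [← Finset.sum_sub_distrib, Finset.sum_eq_single i]
      · rw [abs_le]
        constructor <;> linarith [lcH_nonneg hw0 (y := y) q (z i), lcH_nonneg hw0 (y := y) q (z' i),
          lcH_le hw1 (y := y) q (z i), lcH_le hw1 (y := y) q (z' i)]
      · intro j _ hj; rw [h j hj, sub_self]
      · simp
    have h3 : (n:ℝ)⁻¹ * ∑ i, lcH y w q (z i) - ∫ x, lcH y w q x ∂ν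
      = ((n:ℝ)⁻¹ * ∑ i, lcH y w q (z' i) - ∫ x, lcH y w q x ∂ν)
        + (n:ℝ)⁻¹ * (∑ j, lcH y w q (z j) - ∑ j, lcH y w q (z' j)) := by ring
    rw [h3]
    refine (abs_add_le _ _).trans (add_le_add h1 ?_)
    rw [abs_mul, abs_of_nonneg (by positivity : (0:ℝ) ≤ (n:ℝ)⁻¹)]
    exact mul_le_of_le_one_right (by positivity) h2
  have h1 := key (Function.update z i x) z fun j hj => by simp [hj]
  have h2 := key z (Function.update z i x) fun j hj => by simp [hj]
  rw [abs_le]; constructor <;> linarith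

noncomputable def lcT (n : ℕ) (ε : Fin n → Bool) (p : Fin n → E × E) : Fin n → E × E :=
  fun i => (if ε i then id else Prod.swap) (p i)

lemma lcT_mp (ν : Measure E) [IsProbabilityMeasure ν] (n : ℕ) (ε : Fin n → Bool) :
    MeasurePreserving (lcT n ε) (Measure.pi fun _ => ν.prod ν) (Measure.pi fun _ : Fin n => ν.prod ν) := by
  refine measurePreserving_pi (fun _ => ν.prod ν) (fun _ => ν.prod ν) (f := fun i => if ε i then id else Prod.swap) fun i => ?_
  by_cases h : ε i
  · simp only [h, if_true]; exact MeasurePreserving.id _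
  · simp only [h]; exact Measure.measurePreserving_swap

noncomputable def lcGp {n : ℕ} (y w : E → ℝ) (p : Fin n → E × E) : ℝ := lcG y w (fun i => (p i).1, fun i => (p i).2)

lemma lcGp_sum (hw0 : ∀ z, 0 ≤ w z) (hw1 : ∀ z, w z ≤ 1) {n : ℕ} (hn : 0 < n) (p : Fin n → E × E) :
    ∑ ε, lcGp y w (lcT n ε p) ≤ 2^n * (4 * √n) := by
  obtain ⟨B1, h1, s1⟩ := lc_rad n hn (fun i => w (p i).1) (fun i => y (p i).1) 
    (fun i => by rw [abs_of_nonneg (hw0 _)]; exact hw1 _)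
  obtain ⟨B2, h2, s2⟩ := lc_rad n hn (fun i => w (p i).2) (fun i => y (p i).2) 
    (fun i => by rw [abs_of_nonneg (hw0 _)]; exact hw1 _)
  have : ∀ ε, lcGp y w (lcT n ε p) ≤ B1 ε + B2 ε := by
    intro ε
    refine ciSup_le fun q => ?_
    have e : ∑ i, (lcH y w q (lcT n ε p i).1 - lcH y w q (lcT n ε p i).2)
      = (∑ i, lcSgn (ε i) * (if (q:ℝ) ≤ y (p i).1 then w (p i).1 else 0)) 
        - ∑ i, lcSgn (ε i) * (if (q:ℝ) ≤ y (p i).2 then w (p i).2 else 0) := by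
      rw [← Finset.sum_sub_distrib]
      refine Finset.sum_congr rfl fun i _ => ?_
      cases h : ε i
      · simp only [lcT, h, lcSgn, lcH]; simp only [Bool.false_eq_true, if_false, Prod.fst_swap, Prod.snd_swap]; ring
      · simp only [lcT, h, lcSgn, lcH]; simp
    simp only
    rw [e]
    exact (abs_sub _ _).trans (add_le_add (h1 ε q) (h2 ε q))
  calc _ ≤ ∑ ε, (B1 ε + B2 ε) := Finset.sum_le_sum fun ε _ => this ε
    _ ≤ 2^n * (4 * √n) := by rw [Finset.sum_add_distrib]; linarith

lemma lcG_int_le (ν : Measure E) [IsProbabilityMeasure ν] (hy : Measurable y) (hw : Measurable w)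
    (hw0 : ∀ z, 0 ≤ w z) (hw1 : ∀ z, w z ≤ 1) {n : ℕ} (hn : 0 < n) :
    ∫ p, lcG y w p ∂((Measure.pi fun _ : Fin n => ν).prod (Measure.pi fun _ : Fin n => ν)) ≤ 4 * √n := by
  have hmp := measurePreserving_arrowProdEquivProdArrow E E (Fin n) (fun _ => ν) (fun _ => ν)
  rw [← hmp.integral_comp']
  have hGm : Measurable (lcGp y w : (Fin n → E × E) → ℝ) := by
    unfold lcGp
    exact (lcG_meas hy hw).comp (by fun_prop)
  have hT : ∀ ε, ∫ p, lcGp y w (lcT n ε p) ∂(Measure.pi fun _ => ν.prod ν) = ∫ p, lcGp y w p ∂(Measure.pi fun _ : Fin n => ν.prod ν) := by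
    intro ε
    have := lcT_mp ν n ε
    conv_rhs => rw [← this.map_eq]
    rw [integral_map this.measurable.aemeasurable hGm.aestronglyMeasurable]
  have hI : ∀ ε, Integrable (fun p => lcGp y w (lcT n ε p)) (Measure.pi fun _ : Fin n => ν.prod ν) := fun ε =>
    Integrable.of_bound (C := n) (hGm.comp (lcT_mp ν n ε).measurable).aestronglyMeasurable
      (Filter.Eventually.of_forall fun p => lcG_le hw0 hw1 _)
  have h1 : (2:ℝ)^n * ∫ p, lcGp y w p ∂(Measure.pi fun _ : Fin n => ν.prod ν) ≤ 2^n * (4 * √n) := by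
    calc _ = ∑ ε, ∫ p, lcGp y w (lcT n ε p) ∂(Measure.pi fun _ => ν.prod ν) := by
            simp only [hT]; simp
      _ = ∫ p, ∑ ε, lcGp y w (lcT n ε p) ∂(Measure.pi fun _ => ν.prod ν) := 
            (integral_finsetSum _ fun ε _ => hI ε).symm
      _ ≤ ∫ p, 2^n * (4 * √n) ∂(Measure.pi fun _ : Fin n => ν.prod ν) :=
            integral_mono (integrable_finsetSum _ fun ε _ => hI ε) (integrable_const _) fun p => lcGp_sum hw0 hw1 hn p
      _ = _ := by simp
  exact le_of_mul_le_mul_left h1 (by positivity)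

lemma lcF_int_le (ν : Measure E) [IsProbabilityMeasure ν] (hy : Measurable y) (hw : Measurable w)
    (hw0 : ∀ z, 0 ≤ w z) (hw1 : ∀ z, w z ≤ 1) {n : ℕ} (hn : 0 < n) :
    ∫ z, lcF ν y w z ∂(Measure.pi fun _ : Fin n => ν) ≤ 4 / √n := by
  have hGi : Integrable (lcG y w) ((Measure.pi fun _ : Fin n => ν).prod (Measure.pi fun _ : Fin n => ν)) :=
    Integrable.of_bound (C := n) (lcG_meas hy hw).aestronglyMeasurable
      (Filter.Eventually.of_forall fun p => lcG_le hw0 hw1 _)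
  have hGz : ∀ z : Fin n → E, Integrable (fun z' => lcG y w (z, z')) (Measure.pi fun _ : Fin n => ν) := fun z =>
    Integrable.of_bound (C := n) ((lcG_meas hy hw).comp measurable_prodMk_left).aestronglyMeasurable
      (Filter.Eventually.of_forall fun p => lcG_le hw0 hw1 _)
  have hev : ∀ (q : ℝ) (i : Fin n), Integrable (fun z' : Fin n → E => lcH y w q (z' i)) (Measure.pi fun _ : Fin n => ν) := fun q i =>
    Integrable.of_bound (C := 1) ((lcH_meas hy hw q).comp (measurable_pi_apply i)).aestronglyMeasurable
      (Filter.Eventually.of_forall fun z => by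
        rw [Real.norm_eq_abs, abs_of_nonneg (lcH_nonneg hw0 _ _)]; exact lcH_le hw1 _ _)
  have hevv : ∀ (q : ℝ) (i : Fin n), ∫ z' : Fin n → E, lcH y w q (z' i) ∂(Measure.pi fun _ : Fin n => ν) = ∫ x, lcH y w q x ∂ν := by
    intro q i
    have := measurePreserving_eval (fun _ : Fin n => ν) i
    conv_rhs => rw [← this.map_eq]
    rw [integral_map this.measurable.aemeasurable (lcH_meas hy hw q).aestronglyMeasurable]
  have hn' : (0:ℝ) < n := by positivity
  have hpt : ∀ z : Fin n → E, lcF ν y w z ≤ (n:ℝ)⁻¹ * ∫ z', lcG y w (z, z') ∂(Measure.pi fun _ : Fin n => ν) := by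
    intro z
    refine ciSup_le fun q => ?_
    have e : (n:ℝ)⁻¹ * ∑ i, lcH y w q (z i) - ∫ x, lcH y w q x ∂ν = 
        (n:ℝ)⁻¹ * ∫ z', ∑ i, (lcH y w q (z i) - lcH y w q (z' i)) ∂(Measure.pi fun _ : Fin n => ν) := by
      have hI : ∀ i : Fin n, Integrable (fun z' : Fin n → E => lcH y w q (z i) - lcH y w q (z' i)) (Measure.pi fun _ : Fin n => ν) := fun i => (integrable_const _).sub (hev q i)
      rw [integral_finsetSum _ fun i _ => hI i]
      simp_rw [integral_sub (integrable_const _) (hev q _), hevv]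
      simp
      field_simp
    rw [e, abs_mul, abs_of_pos (inv_pos.2 hn')]
    gcongr
    rw [← Real.norm_eq_abs]
    exact norm_integral_le_of_norm_le (hGz z) (Filter.Eventually.of_forall fun z' => lc_le_G hw0 hw1 (z, z') q)
  calc _ ≤ ∫ z, (n:ℝ)⁻¹ * ∫ z', lcG y w (z, z') ∂(Measure.pi fun _ : Fin n => ν) ∂(Measure.pi fun _ : Fin n => ν) := by
        refine integral_mono ?_ (hGi.integral_prod_left.const_mul _) hpt
        exact Integrable.of_bound (C := 1) (lcF_meas ν hy hw).aestronglyMeasurable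
          (Filter.Eventually.of_forall fun p => lcF_le ν hy hw hw0 hw1 hn _)
    _ = (n:ℝ)⁻¹ * ∫ p, lcG y w p ∂((Measure.pi fun _ : Fin n => ν).prod (Measure.pi fun _ : Fin n => ν)) := by
        rw [integral_const_mul, integral_prod _ hGi]
    _ ≤ (n:ℝ)⁻¹ * (4 * √n) := by
        gcongr; exact lcG_int_le ν hy hw hw0 hw1 hn
    _ = 4 / √n := by
        have : √(n:ℝ) * √n = n := by simp
        field_simp
        rw [Real.sq_sqrt (by positivity)]

lemma lcF_tail (ν : Measure E) [IsProbabilityMeasure ν] (hy : Measurable y) (hw : Measurable w)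
    (hw0 : ∀ z, 0 ≤ w z) (hw1 : ∀ z, w z ≤ 1) {n : ℕ} (hn : 0 < n) (s : ℝ) (hs : 0 ≤ s) :
    (Measure.pi fun _ : Fin n => ν).real {z | s ≤ lcF ν y w z} ≤ exp 32 * exp (-(n * s^2)) := by
  have hn' : (0:ℝ) < n := by positivity
  set m := ∫ z, lcF ν y w z ∂(Measure.pi fun _ : Fin n => ν) with hm
  have hm4 : m ≤ 4 / √n := lcF_int_le ν hy hw hw0 hw1 hn
  have hsq : √(n:ℝ)^2 = n := Real.sq_sqrt hn'.le
  have hsp : 0 < √(n:ℝ) := by positivity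
  have hx : (n:ℝ) * s^2 = (√n * s)^2 := by rw [mul_pow, hsq]
  rcases lt_or_ge s (4 / √n) with h | h
  · have h1 : √n * s ≤ 4 := by
      rw [lt_div_iff₀ hsp] at h; linarith
    have h0 : 0 ≤ √n * s := by positivity
    rw [← exp_add, hx]
    refine measureReal_le_one.trans (one_le_exp ?_)
    nlinarith
  · have hc : 0 ≤ (n:ℝ)⁻¹ := by positivity
    set l : ℝ := 4 * n * (s - 4 / √n) with hl
    have hl0 : 0 ≤ l := by
      have : 0 ≤ s - 4 / √n := by linarith
      positivity
    have hmcd := lc_mcd ν (n:ℝ)⁻¹ hc l n (lcF ν y w) (lcF_meas ν hy hw) 1 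
      (fun z => lcF_le ν hy hw hw0 hw1 hn z) (fun z i x => lcF_diff ν hy hw hw0 hw1 hn z i x)
    rw [← hm] at hmcd
    have hch := measure_ge_le_exp_mul_mgf (μ := Measure.pi fun _ : Fin n => ν) (X := fun z => lcF ν y w z - m) (s - 4 / √n) hl0 (by
      refine Integrable.of_bound (C := rexp (|l| * (1 + |m|))) ?_ ?_
      · have := lcF_meas ν hy hw (n := n)
        exact Measurable.aestronglyMeasurable (by fun_prop)
      · refine Filter.Eventually.of_forall fun z => ?_
        rw [Real.norm_eq_abs, abs_of_pos (exp_pos _)]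
        refine exp_le_exp.2 ((le_abs_self _).trans ?_)
        rw [abs_mul]
        gcongr
        exact (abs_sub _ _).trans (by gcongr; exact lcF_le ν hy hw hw0 hw1 hn z))
    simp only [mgf] at hch
    calc _ ≤ (Measure.pi fun _ : Fin n => ν).real {z | s - 4 / √n ≤ lcF ν y w z - m} := by
          refine measureReal_mono ?_
          intro z (hz : s ≤ _)
          show s - 4 / √n ≤ lcF ν y w z - m
          linarith
      _ ≤ _ := hch
      _ ≤ rexp (-l * (s - 4 / √n)) * rexp (n * (n:ℝ)⁻¹^2 * l^2 / 8) := by gcongr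
      _ ≤ _ := by
          rw [← exp_add, ← exp_add]
          refine exp_le_exp.2 ?_
          have e : -l * (s - 4 / √n) + n * (n:ℝ)⁻¹^2 * l^2 / 8 = -2 * (√n * s - 4)^2 := by
            have : √n * s - 4 = √n * (s - 4 / √n) := by field_simp
            rw [this, mul_pow (√(n:ℝ)), hsq, hl]
            field_simp
            ring
          rw [e, hx]
          nlinarith [sq_nonneg (√n * s - 8)]

lemma lc_lim (ν : Measure E) [IsProbabilityMeasure ν] (hy : Measurable y) (hw : Measurable w)
    (hw0 : ∀ z, 0 ≤ w z) (hw1 : ∀ z, w z ≤ 1) {n : ℕ} (hn : 0 < n) (z : Fin n → E) (t : ℝ) :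
    |(n:ℝ)⁻¹ * ∑ i, lcH y w t (z i) - ∫ x, lcH y w t x ∂ν| ≤ lcF ν y w z := by
  obtain ⟨u, -, hu, hut⟩ := Real.exists_seq_rat_strictMono_tendsto t
  have hH : ∀ x, Filter.Tendsto (fun k => lcH y w (u k) x) Filter.atTop (nhds (lcH y w t x)) := by
    intro x
    by_cases h : t ≤ y x
    · have : ∀ k, lcH y w (u k) x = lcH y w t x := fun k => by
        have h2 : (u k : ℝ) ≤ y x := (hu k).le.trans h
        simp [lcH, h, h2]
      simp only [this]; exact tendsto_const_nhds
    · refine tendsto_const_nhds.congr' ?_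
      filter_upwards [hut.eventually (lt_mem_nhds (not_le.1 h))] with k hk
      simp [lcH, h, not_le.2 hk]
  have hI : Filter.Tendsto (fun k => ∫ x, lcH y w (u k) x ∂ν) Filter.atTop (nhds (∫ x, lcH y w t x ∂ν)) := by
    refine tendsto_integral_of_dominated_convergence (fun _ => 1) (fun k => (lcH_meas hy hw _).aestronglyMeasurable)
      (integrable_const _) (fun k => Filter.Eventually.of_forall fun x => ?_) (Filter.Eventually.of_forall hH)
    rw [Real.norm_eq_abs, abs_of_nonneg (lcH_nonneg hw0 _ _)]; exact lcH_le hw1 _ _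
  have hS : Filter.Tendsto (fun k => |(n:ℝ)⁻¹ * ∑ i, lcH y w (u k) (z i) - ∫ x, lcH y w (u k) x ∂ν|) Filter.atTop
      (nhds |(n:ℝ)⁻¹ * ∑ i, lcH y w t (z i) - ∫ x, lcH y w t x ∂ν|) :=
    (((tendsto_finsetSum _ fun i _ => hH (z i)).const_mul _).sub hI).abs
  exact le_of_tendsto hS (Filter.Eventually.of_forall fun k => lc_le_F ν hy hw hw0 hw1 hn z (u k))

end

theorem lasso_cox_lemma_3_3 :
    ∃ W : ℝ, 0 < W ∧
      ∀
    (Ω : Type u) [MeasurableSpace Ω] (𝓧 : Type v) [MeasurableSpace 𝓧] [Nonempty 𝓧]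
    (P : Measure Ω) [IsProbabilityMeasure P]
    (n m : ℕ) (hn : 0 < n) (hm : 1 ≤ m)
    (τ : ℝ) (hτ : 0 < τ)
    (Y : Ω → ℝ) (Δ : Ω → ℝ) (X : Ω → 𝓧)
    (hYmeas : Measurable Y) (hΔmeas : Measurable Δ) (hXmeas : Measurable X)
    (hYrange : ∀ ω, Y ω ∈ Set.Icc 0 τ) (hΔrange : ∀ ω, Δ ω = 0 ∨ Δ ω = 1)
    (pr : ℝ) (hprdef : pr = (P {ω | τ ≤ Y ω}).toReal) (hprpos : 0 < pr)
    (Yi : Fin n → Ω → ℝ) (Δi : Fin n → Ω → ℝ) (Xi : Fin n → Ω → 𝓧)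
    (hsamplemeas : ∀ i, Measurable (fun ω => (Yi i ω, Δi i ω, Xi i ω)))
    (hindep : iIndepFun (fun i ω => (Yi i ω, Δi i ω, Xi i ω)) P)
    (hident : ∀ i, IdentDistrib (fun ω => (Yi i ω, Δi i ω, Xi i ω)) (fun ω => (Y ω, Δ ω, X ω)) P P)
    (ψ : Fin m → 𝓧 → ℝ)
    (hψmeas : ∀ k, Measurable (ψ k))
    (hψbdd : ∀ k, BddAbove (Set.range fun x => |ψ k x|))
    (σ : Fin m → ℝ)
    (hσdef : ∀ k, σ k = Real.sqrt (∫ ω, (ψ k (X ω))^2 ∂P))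
    (hσpos : ∀ k, 0 < σ k)
    (Km : ℝ) (hKm : Km = ⨆ k, (⨆ x, |ψ k x|) / σ k)
    (Θ : Set (Fin m → ℝ)) (hΘconv : Convex ℝ Θ) (hΘne : Θ.Nonempty)
    (Lm : ℝ) (hLm : Lm = ⨆ θ : Θ, ∑ k, |(θ : Fin m → ℝ) k|)
    (hLbdd : BddAbove (Set.range fun θ : Θ => ∑ k, |(θ : Fin m → ℝ) k|))
    (fθ : (Fin m → ℝ) → 𝓧 → ℝ) (hfθ : ∀ θ x, fθ θ x = ∑ k, θ k * ψ k x)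
    (Inorm : (Fin m → ℝ) → ℝ) (hInorm : ∀ θ, Inorm θ = ∑ k, σ k * |θ k|)
    (σmax : ℝ) (hσmax : σmax = ⨆ k, σ k)
    (Um : ℝ) (hUm : Um = Real.exp (Km * Lm * σmax))
    (μ : (𝓧 → ℝ) → ℝ → ℝ)
    (hμ : ∀ g t, μ g t = ∫ ω, (if t ≤ Y ω then Real.exp (g (X ω)) else 0) ∂P)
    (an abar : ℝ)
    (han : an = Real.sqrt (2 * Km^2 * Real.log (2*m) / n) + Km * Real.log (2*m) / n)
    (habar : abar = 4 * an),
      ∀ θ ∈ Θ, ∀ r₁ : ℝ, 0 < r₁ →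
        (P {ω | Um * abar * r₁ ≤
            ⨆ t : Set.Icc (0:ℝ) τ,
              |(n:ℝ)⁻¹ * (∑ i, if t.1 ≤ Yi i ω then Real.exp (fθ θ (Xi i ω)) else 0) -
                μ (fθ θ) t.1|}).toReal ≤
          W^2 / 5 * Real.exp (-(n * abar^2 * r₁^2)) := by
  refine ⟨√(5 * exp 32), by positivity, ?_⟩
  intro Ω _ 𝓧 _ _ P _ n m hn hm τ hτ Y Δ X hY hΔ hX _ _ _ _ _ Yi Δi Xi hs hind hid ψ hψ hψb σ _ hσ
    Km hKm Θ _ _ Lm hLm hLb fθ hf _ _ σmax hσm Um hUm μ hμ an abar han habar θ hθ r hr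
  rw [Real.sq_sqrt (by positivity), mul_div_cancel_left₀ _ (by norm_num)]
  have hKm0 : 0 ≤ Km := by
    rw [hKm]
    exact Real.iSup_nonneg fun k => div_nonneg (Real.iSup_nonneg fun _ => abs_nonneg _) (hσ k).le
  have hσm0 : 0 ≤ σmax := by
    rw [hσm]; exact Real.iSup_nonneg fun k => (hσ k).le
  have hψle : ∀ k x, |ψ k x| ≤ Km * σmax := by
    intro k x
    have h1 : |ψ k x| ≤ ⨆ x, |ψ k x| := le_ciSup (hψb k) x
    have h2 : (⨆ x, |ψ k x|) / σ k ≤ Km := by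
      rw [hKm]
      exact le_ciSup (f := fun k => (⨆ x, |ψ k x|) / σ k) (Set.finite_range _).bddAbove k
    have h3 : σ k ≤ σmax := by
      rw [hσm]; exact le_ciSup (Set.finite_range _).bddAbove k
    rw [div_le_iff₀ (hσ k)] at h2
    exact h1.trans (h2.trans (by gcongr))
  have hL : ∑ k, |θ k| ≤ Lm := by
    rw [hLm]
    exact le_ciSup hLb ⟨θ, hθ⟩
  have hfle : ∀ x, fθ θ x ≤ Km * Lm * σmax := by
    intro x
    rw [hf]
    calc ∑ k, θ k * ψ k x ≤ ∑ k, |θ k| * (Km * σmax) := Finset.sum_le_sum fun k _ => by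
          refine (le_abs_self _).trans ?_
          rw [abs_mul]
          gcongr
          exact hψle k x
      _ = (∑ k, |θ k|) * (Km * σmax) := by rw [Finset.sum_mul]
      _ ≤ Lm * (Km * σmax) := by gcongr
      _ = _ := by ring
  have hfm : Measurable (fθ θ) := by
    have : fθ θ = fun x => ∑ k, θ k * ψ k x := funext fun x => hf θ x
    rw [this]
    fun_prop
  have hU : 0 < Um := by rw [hUm]; exact exp_pos _
  have habar0 : 0 ≤ abar := by
    have : 0 ≤ Real.log (2 * m) := Real.log_nonneg (by
      have : (1:ℝ) ≤ m := by exact_mod_cast hm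
      linarith)
    rw [habar, han]
    positivity
  let Z : Ω → ℝ × ℝ × 𝓧 := fun ω => (Y ω, Δ ω, X ω)
  have hZ : Measurable Z := hY.prodMk (hΔ.prodMk hX)
  let ν : Measure (ℝ × ℝ × 𝓧) := P.map Z
  have : IsProbabilityMeasure ν := Measure.isProbabilityMeasure_map hZ.aemeasurable
  let y : ℝ × ℝ × 𝓧 → ℝ := fun z => z.1
  let w : ℝ × ℝ × 𝓧 → ℝ := fun z => exp (fθ θ z.2.2) / Um
  have hy : Measurable y := measurable_fst
  have hw : Measurable w := by
    have : Measurable fun z : ℝ × ℝ × 𝓧 => fθ θ z.2.2 := hfm.comp (measurable_snd.comp measurable_snd)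
    exact (this.exp).div_const _
  have hw0 : ∀ z, 0 ≤ w z := fun z => by positivity
  have hw1 : ∀ z, w z ≤ 1 := fun z => by
    show _ / _ ≤ (1:ℝ)
    rw [div_le_one hU, hUm]
    exact exp_le_exp.2 (hfle _)
  let S : Ω → Fin n → ℝ × ℝ × 𝓧 := fun ω i => (Yi i ω, Δi i ω, Xi i ω)
  have hS : Measurable S := measurable_pi_lambda _ hs
  have hmap : P.map S = Measure.pi fun _ => ν := by
    have := (iIndepFun_iff_map_fun_eq_pi_map fun i => (hs i).aemeasurable).1 hind
    rw [show S = fun ω i => (Yi i ω, Δi i ω, Xi i ω) from rfl, this]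
    congr 1
    funext i
    exact (hid i).map_eq
  have hsub : {ω | Um * abar * r ≤ ⨆ t : Set.Icc (0:ℝ) τ,
              |(n:ℝ)⁻¹ * (∑ i, if t.1 ≤ Yi i ω then Real.exp (fθ θ (Xi i ω)) else 0) -
                μ (fθ θ) t.1|} ⊆ S ⁻¹' {z | abar * r ≤ lcF ν y w z} := by
    intro ω hω
    have : Nonempty (Set.Icc (0:ℝ) τ) := ⟨⟨0, le_rfl, hτ.le⟩⟩
    have hle : (⨆ t : Set.Icc (0:ℝ) τ,
              |(n:ℝ)⁻¹ * (∑ i, if t.1 ≤ Yi i ω then Real.exp (fθ θ (Xi i ω)) else 0) -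
                μ (fθ θ) t.1|) ≤ Um * lcF ν y w (S ω) := by
      refine ciSup_le fun t => ?_
      have h := lc_lim ν hy hw hw0 hw1 hn (S ω) t.1
      have e1 : ∀ z, lcH y w t.1 z = Um⁻¹ * (if t.1 ≤ z.1 then exp (fθ θ z.2.2) else 0) := by
        intro z
        simp only [lcH, y, w]
        split_ifs
        · rw [div_eq_inv_mul]
        · simp
      have e2 : ∫ x, lcH y w t.1 x ∂ν = Um⁻¹ * μ (fθ θ) t.1 := by
        rw [integral_map hZ.aemeasurable (lcH_meas hy hw _).aestronglyMeasurable, hμ, ← integral_const_mul]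
        simp only [e1, Z]
      rw [e2] at h
      simp only [e1, ← Finset.mul_sum] at h
      rw [mul_left_comm, ← mul_sub, abs_mul, abs_of_pos (inv_pos.2 hU), inv_mul_le_iff₀ hU] at h
      exact h
    have h := (show _ ≤ _ from hω).trans hle
    rw [mul_assoc] at h
    exact le_of_mul_le_mul_left h hU
  have hmeas : MeasurableSet {z : Fin n → ℝ × ℝ × 𝓧 | abar * r ≤ lcF ν y w z} :=
    measurableSet_le measurable_const (lcF_meas ν hy hw)
  have htail := lcF_tail ν hy hw hw0 hw1 hn (abar * r) (by positivity)
  calc _ ≤ (P (S ⁻¹' {z | abar * r ≤ lcF ν y w z})).toReal :=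
        ENNReal.toReal_mono (measure_ne_top _ _) (measure_mono hsub)
    _ = (Measure.pi fun _ : Fin n => ν).real {z | abar * r ≤ lcF ν y w z} := by
        rw [← hmap, measureReal_def, Measure.map_apply hS hmeas]
    _ ≤ _ := htail
    _ = _ := by rw [mul_pow, mul_assoc]
end

section
/- There exists a constant W > 0 (not depending on n, m, the distribution of (Y, Δ, X), or θ) such that for all M > 0, all r₁ > 0, and all θ ∈ Θ with I(θ − θ*) ≤ M, P( R_θ ≥ λ̄^B_{n,0}(r₁) · M ) ≤ 2 exp(−n π²/2) + (3/10) W² exp(−n ā_n² r₁²), where λ̄^B_{n,0}(r₁) := (2 K_m U_m² / π)(2 ā_n r₁ + √(log(2m)/n)). (Corollary 3.2) -/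
set_option linter.unusedVariables false

open MeasureTheory ProbabilityTheory Real Finset

universe u v

theorem aux_mgf {S : Type*} [MeasurableSpace S] (Q : Measure S) [IsProbabilityMeasure Q]
    (n : ℕ) (i : Fin n) (G : S → S → ℝ) (hG : Measurable (Function.uncurry G)) (w : ℝ)
    (hw : ∀ z, ∃ a b, a ≤ 0 ∧ 0 ≤ b ∧ b - a ≤ w ∧ ∀ z', G z z' ∈ Set.Icc a b)
    (h0 : ∀ z, ∫ z', G z z' ∂Q = 0) (l : ℝ) :
    Integrable (fun z : Fin n → S => exp (l * ∑ j, G (z i) (z j))) (Measure.pi fun _ => Q) ∧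
    ∫ z : Fin n → S, exp (l * ∑ j, G (z i) (z j)) ∂(Measure.pi fun _ => Q)
      ≤ exp (|l| * w + n * (l^2 * w^2 / 8)) := by
  have hbd : ∀ z z', |G z z'| ≤ w := by
    intro z z'
    obtain ⟨a, b, ha, hb, hab, h⟩ := hw z
    have := h z'
    rw [abs_le]; constructor <;> linarith [this.1, this.2]
  have hlG : ∀ z z', l * G z z' ≤ |l| * w := fun z z' => by
    calc l * G z z' ≤ |l * G z z'| := le_abs_self _
      _ = |l| * |G z z'| := abs_mul _ _
      _ ≤ _ := by gcongr; exact hbd z z'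
  have hGm : ∀ z, Measurable (G z) := fun z => hG.comp (measurable_const.prodMk measurable_id)
  have hmgf : ∀ z, ∫ z', exp (l * G z z') ∂Q ≤ exp (l^2 * w^2 / 8) := by
    intro z
    obtain ⟨a, b, ha, hb, hab, h⟩ := hw z
    have := (hasSubgaussianMGF_of_mem_Icc_of_integral_eq_zero (μ := Q) (hGm z).aemeasurable
      (Filter.Eventually.of_forall h) (h0 z)).mgf_le l
    refine this.trans ?_
    rw [exp_le_exp]
    push_cast
    rw [Real.norm_of_nonneg (by linarith)]
    have : (b - a)^2 ≤ w^2 := by gcongr; linarith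
    nlinarith [mul_le_mul_of_nonneg_left this (sq_nonneg l)]
  have hint : Integrable (fun z : Fin n → S => exp (l * ∑ j, G (z i) (z j)))
      (Measure.pi fun _ => Q) := by
    refine Integrable.of_bound (C := exp (n * (|l| * w))) ?_ ?_
    · apply Measurable.aestronglyMeasurable
      refine measurable_exp.comp (measurable_const.mul (Finset.measurable_sum _ fun j _ => ?_))
      exact hG.comp (f := fun z : Fin n → S => (z i, z j)) ((measurable_pi_apply i).prodMk (measurable_pi_apply j))
    · refine Filter.Eventually.of_forall fun z => ?_
      rw [Real.norm_of_nonneg (exp_pos _).le, exp_le_exp, Finset.mul_sum]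
      calc _ ≤ ∑ j : Fin n, |l| * w := Finset.sum_le_sum fun j _ => hlG _ _
        _ = _ := by simp
  refine ⟨hint, ?_⟩
  obtain _ | n := n
  · exact i.elim0
  have mp := (measurePreserving_piFinSuccAbove (fun _ : Fin (n+1) => Q) i).symm
  rw [← mp.integral_comp']
  rw [← mp.integrable_comp_emb (MeasurableEquiv.measurableEmbedding _)] at hint
  simp only [Function.comp_def] at hint
  rw [integral_prod _ hint]
  have key : ∀ x : S, ∫ y : Fin n → S, exp (l * ∑ j, G x (y j)) ∂(Measure.pi fun _ => Q)
      ≤ exp (n * (l^2 * w^2 / 8)) := by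
    intro x
    simp_rw [Finset.mul_sum, exp_sum]
    rw [integral_fintype_prod_eq_prod (μ := fun _ : Fin n => Q) (fun _ y => exp (l * G x y))]
    rw [Finset.prod_const, exp_nat_mul]
    simp only [card_univ, Fintype.card_fin]
    exact pow_le_pow_left₀ (integral_nonneg fun _ => (exp_pos _).le) (hmgf x) n
  have e : ∀ x : S, ∀ y : Fin n → S, exp (l * ∑ j, G (((MeasurableEquiv.piFinSuccAbove (fun _ : Fin (n+1) => S) i).symm (x, y)) i) (((MeasurableEquiv.piFinSuccAbove (fun _ : Fin (n+1) => S) i).symm (x, y)) j))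
     = exp (l * G x x) * exp (l * ∑ j, G x (y j)) := by
    intro x y
    rw [← exp_add, ← mul_add, Fin.sum_univ_succAbove _ i]
    simp [MeasurableEquiv.piFinSuccAbove_symm_apply, Fin.insertNthEquiv]
  simp_rw [e, integral_const_mul]
  have hle : ∀ x : S, exp (l * G x x) * ∫ y : Fin n → S, exp (l * ∑ j, G x (y j)) ∂(Measure.pi fun _ => Q) ≤ exp (|l| * w + (n+1 : ℕ) * (l^2 * w^2 / 8)) := by
    intro x
    calc _ ≤ exp (|l| * w) * exp (n * (l^2 * w^2 / 8)) := by
          exact mul_le_mul (exp_le_exp.2 (hlG x x)) (key x)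
            (integral_nonneg fun _ => (exp_pos _).le) (exp_pos _).le
      _ ≤ _ := by
          rw [← exp_add, exp_le_exp]; push_cast; nlinarith [mul_nonneg (sq_nonneg l) (sq_nonneg w)]
  calc _ ≤ ∫ x : S, exp (|l| * w + (n+1 : ℕ) * (l^2 * w^2 / 8)) ∂Q := by
        refine integral_mono_of_nonneg (Filter.Eventually.of_forall fun x => ?_) (integrable_const _) (Filter.Eventually.of_forall hle)
        exact mul_nonneg (exp_pos _).le (integral_nonneg fun _ => (exp_pos _).le)
    _ = _ := by simp

theorem aux_tail {S : Type*} [MeasurableSpace S] (Q : Measure S) [IsProbabilityMeasure Q]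
    (n N : ℕ) (hn : 0 < n) (hN : 0 < N) (G : Fin N → S → S → ℝ)
    (hG : ∀ k, Measurable (Function.uncurry (G k))) (w : ℝ)
    (hw : ∀ k z, ∃ a b, a ≤ 0 ∧ 0 ≤ b ∧ b - a ≤ w ∧ ∀ z', G k z z' ∈ Set.Icc a b)
    (h0 : ∀ k z, ∫ z', G k z z' ∂Q = 0) (l : ℝ) (hl : 0 ≤ l) (x : ℝ) :
    (Measure.pi fun _ : Fin n => Q).real
      {z | x ≤ ∑ k, ∑ i, ((N:ℝ) * n)⁻¹ * |∑ j, G k (z i) (z j)|}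
      ≤ 2 * exp (- (l * x) + l * w + n * (l^2 * w^2 / 8)) := by
  set C := exp (l * w + n * (l^2 * w^2 / 8)) with hC
  set c : ℝ := ((N:ℝ) * n)⁻¹ with hc
  have hNn : (0:ℝ) < N * n := by positivity
  have hcpos : 0 < c := by positivity
  have hp : ∀ k i, _ := fun k i => aux_mgf Q n i (G k) (hG k) w (hw k) (h0 k) l
  have hm : ∀ k i, _ := fun k i => aux_mgf Q n i (G k) (hG k) w (hw k) (h0 k) (-l)
  set F : (Fin n → S) → ℝ := fun z => ∑ k, ∑ i, c * (exp (l * ∑ j, G k (z i) (z j)) + exp (-l * ∑ j, G k (z i) (z j))) with hF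
  have hadd : ∀ k i, Integrable (fun z : Fin n → S => c * (exp (l * ∑ j, G k (z i) (z j)) + exp (-l * ∑ j, G k (z i) (z j)))) (Measure.pi fun _ : Fin n => Q) :=
    fun k i => ((hp k i).1.add (hm k i).1).const_mul _
  have hint : Integrable F (Measure.pi fun _ : Fin n => Q) :=
    integrable_finsetSum _ fun k _ => integrable_finsetSum _ fun i _ => hadd k i
  have hFint : ∫ z, F z ∂(Measure.pi fun _ : Fin n => Q) ≤ 2 * C := by
    simp only [hF]
    rw [integral_finsetSum _ fun k _ => integrable_finsetSum _ fun i _ => hadd k i]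
    have : ∀ k : Fin N, ∫ z, ∑ i, c * (exp (l * ∑ j, G k (z i) (z j)) + exp (-l * ∑ j, G k (z i) (z j))) ∂(Measure.pi fun _ : Fin n => Q) ≤ ∑ i : Fin n, c * (2 * C) := by
      intro k
      rw [integral_finsetSum _ fun i _ => hadd k i]
      refine Finset.sum_le_sum fun i _ => ?_
      rw [integral_const_mul]
      refine mul_le_mul_of_nonneg_left ?_ hcpos.le
      rw [integral_add (hp k i).1 (hm k i).1]
      have h1 := (hp k i).2
      have h2 := (hm k i).2
      rw [abs_neg, neg_sq] at h2
      rw [abs_of_nonneg hl] at h1 h2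
      linarith
    refine (Finset.sum_le_sum fun k _ => this k).trans ?_
    simp only [sum_const, card_univ, Fintype.card_fin, nsmul_eq_mul]
    rw [hc]
    apply le_of_eq
    field_simp
  have hFle : ∀ z : Fin n → S, exp (l * ∑ k, ∑ i, c * |∑ j, G k (z i) (z j)|) ≤ F z := by
    intro z
    have hcx := convexOn_exp.map_sum_le (t := (Finset.univ : Finset (Fin N × Fin n)))
      (w := fun _ => c) (p := fun q => l * |∑ j, G q.1 (z q.2) (z j)|) (fun _ _ => hcpos.le)
      (by simp [hc]; field_simp) (fun _ _ => Set.mem_univ _)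
    simp only [smul_eq_mul, Fintype.sum_prod_type] at hcx
    have e1 : l * ∑ k, ∑ i, c * |∑ j, G k (z i) (z j)| = ∑ k, ∑ i, c * (l * |∑ j, G k (z i) (z j)|) := by
      simp_rw [Finset.mul_sum]
      refine Finset.sum_congr rfl fun k _ => Finset.sum_congr rfl fun i _ => by ring
    rw [e1]
    refine hcx.trans (Finset.sum_le_sum fun k _ => Finset.sum_le_sum fun i _ => ?_)
    refine mul_le_mul_of_nonneg_left ?_ hcpos.le
    rcases abs_cases (∑ j, G k (z i) (z j)) with h | h
    · rw [h.1]; linarith [exp_pos (-l * ∑ j, G k (z i) (z j))]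
    · rw [h.1, mul_neg, ← neg_mul]; linarith [exp_pos (l * ∑ j, G k (z i) (z j))]
  have hmark := mul_meas_ge_le_integral_of_nonneg (μ := Measure.pi fun _ : Fin n => Q) (f := F)
    (Filter.Eventually.of_forall fun z => (exp_pos _).le.trans (hFle z)) hint (exp (l * x))
  have hsub : (Measure.pi fun _ : Fin n => Q).real
      {z | x ≤ ∑ k, ∑ i, c * |∑ j, G k (z i) (z j)|} ≤ (Measure.pi fun _ : Fin n => Q).real {z | exp (l * x) ≤ F z} := by
    refine measureReal_mono ?_ (measure_ne_top _ _)
    intro z hz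
    refine le_trans ?_ (hFle z)
    rw [exp_le_exp]
    exact mul_le_mul_of_nonneg_left hz hl
  have : exp (- (l * x) + l * w + n * (l^2 * w^2 / 8)) = exp (-(l*x)) * C := by
    rw [hC, ← exp_add]; ring_nf
  rw [this]
  have h3 := hmark.trans hFint
  calc _ ≤ _ := hsub
    _ = exp (-(l*x)) * (exp (l * x) * (Measure.pi fun _ : Fin n => Q).real {z | exp (l * x) ≤ F z}) := by
        rw [← mul_assoc, ← exp_add]; simp
    _ ≤ exp (-(l*x)) * (2 * C) := by gcongr
    _ = _ := by ring

theorem aux_log_step (a a' b b' η α : ℝ) (hα : 0 < α) (ha : α ≤ a) (hb : 0 < b)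
    (ha' : exp (-η) * a ≤ a') (hb' : exp (-η) * b ≤ b') :
    |(log a' - log b') - (log a - log b)| ≤ exp η / α * |a' - b' / b * a| := by
  have ha0 : 0 < a := hα.trans_le ha
  have ha0' : 0 < a' := (mul_pos (exp_pos _) ha0).trans_le ha'
  have hb0' : 0 < b' := (mul_pos (exp_pos _) hb).trans_le hb'
  set x := a' / a with hx
  set y := b' / b with hy
  have hx0 : 0 < x := by positivity
  have hy0 : 0 < y := by positivity
  have hxe : exp (-η) ≤ x := by rw [hx, le_div_iff₀ ha0]; exact ha'
  have hye : exp (-η) ≤ y := by rw [hy, le_div_iff₀ hb]; exact hb'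
  have gen : ∀ x y : ℝ, 0 < x → exp (-η) ≤ y → log x - log y ≤ exp η * |x - y| := by
    intro x y hx hy
    have hy0 : 0 < y := (exp_pos _).trans_le hy
    rw [← log_div hx.ne' hy0.ne']
    have h1 := log_le_sub_one_of_pos (div_pos hx hy0)
    have h2 : x / y - 1 = (x - y) / y := by field_simp
    rw [h2] at h1
    refine h1.trans ?_
    rw [div_le_iff₀ hy0]
    have h3 : 1 ≤ exp η * y := by
      calc (1:ℝ) = exp η * exp (-η) := by rw [← exp_add]; simp
        _ ≤ _ := by gcongr
    nlinarith [le_abs_self (x-y), mul_le_mul_of_nonneg_right h3 (abs_nonneg (x-y))]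
  have e1 : (log a' - log b') - (log a - log b) = log x - log y := by
    rw [hx, hy, log_div ha0'.ne' ha0.ne', log_div hb0'.ne' hb.ne']; ring
  have e2 : a' - y * a = a * (x - y) := by rw [hx]; field_simp
  rw [e1, e2, abs_mul, abs_of_pos ha0]
  have h4 : |log x - log y| ≤ exp η * |x - y| := by
    rw [abs_le]; constructor
    · have := gen y x hy0 hxe
      rw [abs_sub_comm] at this; linarith
    · exact gen x y hx0 hye
  refine h4.trans ?_
  have : exp η / α * (a * |x - y|) = exp η * |x-y| * (a / α) := by ring
  rw [this]
  exact le_mul_of_one_le_right (by positivity) (by rw [le_div_iff₀ hα]; linarith)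

/-- at-risk exponential weight -/
noncomputable def auxPhi {X : Type*} (g : X → ℝ) (t : ℝ) (z : ℝ × ℝ × X) : ℝ :=
  if t ≤ z.1 then exp (g z.2.2) else 0

theorem auxPhi_meas {X : Type*} [MeasurableSpace X] (g : X → ℝ) (hg : Measurable g) :
    Measurable (fun p : ℝ × (ℝ × ℝ × X) => auxPhi g p.1 p.2) := by
  unfold auxPhi
  refine Measurable.ite (measurableSet_le measurable_fst (measurable_fst.comp measurable_snd)) ?_
    measurable_const
  fun_prop

theorem auxPhi_nonneg {X : Type*} (g : X → ℝ) (t : ℝ) (z : ℝ × ℝ × X) : 0 ≤ auxPhi g t z := by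
  unfold auxPhi; split_ifs <;> positivity

theorem auxPhi_le {X : Type*} (g : X → ℝ) (B : ℝ) (hg : ∀ x, |g x| ≤ B) (t : ℝ) (z : ℝ × ℝ × X) :
    auxPhi g t z ≤ exp B := by
  unfold auxPhi; split_ifs
  · exact exp_le_exp.2 ((le_abs_self _).trans (hg _))
  · positivity

theorem auxPhi_step {X : Type*} (g g' : X → ℝ) (η : ℝ) (h : ∀ x, |g' x - g x| ≤ η) (t : ℝ)
    (z : ℝ × ℝ × X) :
    exp (-η) * auxPhi g t z ≤ auxPhi g' t z ∧ auxPhi g' t z ≤ exp η * auxPhi g t z := by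
  unfold auxPhi; split_ifs
  · have := abs_le.1 (h z.2.2)
    rw [← exp_add, ← exp_add, exp_le_exp, exp_le_exp]
    constructor <;> linarith
  · simp

theorem auxPhi_lower {X : Type*} (g : X → ℝ) (B : ℝ) (hg : ∀ x, |g x| ≤ B) (t τ : ℝ) (ht : t ≤ τ)
    (z : ℝ × ℝ × X) : exp (-B) * (if τ ≤ z.1 then 1 else 0) ≤ auxPhi g t z := by
  unfold auxPhi
  by_cases h : τ ≤ z.1
  · rw [if_pos h, if_pos (ht.trans h), mul_one, exp_le_exp]
    linarith [(abs_le.1 (hg z.2.2)).1]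
  · rw [if_neg h]; simp; split_ifs <;> positivity

theorem auxPhi_int {X : Type*} [MeasurableSpace X] (Q : Measure (ℝ × ℝ × X)) [IsProbabilityMeasure Q]
    (g : X → ℝ) (hgm : Measurable g) (B : ℝ) (hg : ∀ x, |g x| ≤ B) (t : ℝ) :
    Integrable (auxPhi g t) Q := by
  refine Integrable.of_bound (C := exp B) ?_ (Filter.Eventually.of_forall fun z => ?_)
  · exact ((auxPhi_meas g hgm).comp (measurable_const.prodMk measurable_id)).aestronglyMeasurable
  · rw [Real.norm_of_nonneg (auxPhi_nonneg _ _ _)]; exact auxPhi_le g B hg t z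

noncomputable def auxMu {X : Type*} [MeasurableSpace X] (Q : Measure (ℝ × ℝ × X))
    (g : X → ℝ) (t : ℝ) : ℝ := ∫ z, auxPhi g t z ∂Q

theorem auxMu_meas {X : Type*} [MeasurableSpace X] (Q : Measure (ℝ × ℝ × X)) [IsProbabilityMeasure Q]
    (g : X → ℝ) (hgm : Measurable g) : Measurable (auxMu Q g) :=
  ((auxPhi_meas g hgm).stronglyMeasurable.integral_prod_right (ν := Q)).measurable

theorem auxMu_pos {X : Type*} [MeasurableSpace X] (Q : Measure (ℝ × ℝ × X)) [IsProbabilityMeasure Q]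
    (g : X → ℝ) (hgm : Measurable g) (B : ℝ) (hg : ∀ x, |g x| ≤ B) (t τ : ℝ) (ht : t ≤ τ)
    (hpr : 0 < Q.real {z | τ ≤ z.1}) : 0 < auxMu Q g t := by
  have hms : MeasurableSet {z : ℝ × ℝ × X | τ ≤ z.1} := measurableSet_le measurable_const measurable_fst
  have h : ∫ z, exp (-B) * ({z : ℝ × ℝ × X | τ ≤ z.1}.indicator 1 z) ∂Q ≤ auxMu Q g t := by
    refine integral_mono ?_ (auxPhi_int Q g hgm B hg t) fun z => ?_
    · exact ((integrable_const (1:ℝ)).indicator hms).const_mul _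
    · refine le_trans (le_of_eq ?_) (auxPhi_lower g B hg t τ ht z)
      simp [Set.indicator_apply]
  rw [integral_const_mul, integral_indicator_one hms] at h
  exact (mul_pos (exp_pos _) hpr).trans_le h

theorem auxMu_step {X : Type*} [MeasurableSpace X] (Q : Measure (ℝ × ℝ × X)) [IsProbabilityMeasure Q]
    (g g' : X → ℝ) (hgm : Measurable g) (hgm' : Measurable g') (B : ℝ) (hg : ∀ x, |g x| ≤ B)
    (hg' : ∀ x, |g' x| ≤ B) (η : ℝ) (h : ∀ x, |g' x - g x| ≤ η) (t : ℝ) :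
    exp (-η) * auxMu Q g t ≤ auxMu Q g' t ∧ auxMu Q g' t ≤ exp η * auxMu Q g t := by
  unfold auxMu
  rw [← integral_const_mul, ← integral_const_mul]
  exact ⟨integral_mono ((auxPhi_int Q g hgm B hg t).const_mul _) (auxPhi_int Q g' hgm' B hg' t)
      fun z => (auxPhi_step g g' η h t z).1,
    integral_mono (auxPhi_int Q g' hgm' B hg' t) ((auxPhi_int Q g hgm B hg t).const_mul _)
      fun z => (auxPhi_step g g' η h t z).2⟩

noncomputable def auxG {X : Type*} [MeasurableSpace X] (Q : Measure (ℝ × ℝ × X)) (τ : ℝ)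
    (g g' : X → ℝ) (z z' : ℝ × ℝ × X) : ℝ :=
  auxPhi g' (min z.1 τ) z' - auxMu Q g' (min z.1 τ) / auxMu Q g (min z.1 τ) * auxPhi g (min z.1 τ) z'

theorem auxG_meas {X : Type*} [MeasurableSpace X] (Q : Measure (ℝ × ℝ × X)) [IsProbabilityMeasure Q]
    (τ : ℝ) (g g' : X → ℝ) (hgm : Measurable g) (hgm' : Measurable g') :
    Measurable (Function.uncurry (auxG Q τ g g')) := by
  have hmin : Measurable (fun p : (ℝ × ℝ × X) × (ℝ × ℝ × X) => min p.1.1 τ) := by fun_prop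
  have h2 : Measurable (fun p : (ℝ × ℝ × X) × (ℝ × ℝ × X) => (min p.1.1 τ, p.2)) :=
    hmin.prodMk measurable_snd
  exact ((auxPhi_meas g' hgm').comp h2).sub
    ((((auxMu_meas Q g' hgm').comp hmin).div ((auxMu_meas Q g hgm).comp hmin)).mul
      ((auxPhi_meas g hgm).comp h2))

theorem auxG_range {X : Type*} [MeasurableSpace X] (Q : Measure (ℝ × ℝ × X)) [IsProbabilityMeasure Q]
    (τ : ℝ) (hpr : 0 < Q.real {z | τ ≤ z.1})
    (g g' : X → ℝ) (hgm : Measurable g) (hgm' : Measurable g') (B : ℝ) (hg : ∀ x, |g x| ≤ B)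
    (hg' : ∀ x, |g' x| ≤ B) (η : ℝ) (h : ∀ x, |g' x - g x| ≤ η) (z : ℝ × ℝ × X) :
    ∃ a b, a ≤ 0 ∧ 0 ≤ b ∧ b - a ≤ exp B * (exp η - exp (-η)) ∧
      ∀ z', auxG Q τ g g' z z' ∈ Set.Icc a b := by
  set t := min z.1 τ with ht
  have hpos := auxMu_pos Q g hgm B hg t τ (min_le_right _ _) hpr
  obtain ⟨h1, h2⟩ := auxMu_step Q g g' hgm hgm' B hg hg' η h t
  set y := auxMu Q g' t / auxMu Q g t with hy
  have hy1 : exp (-η) ≤ y := by rw [hy, le_div_iff₀ hpos]; exact h1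
  have hy2 : y ≤ exp η := by rw [hy, div_le_iff₀ hpos]; exact h2
  refine ⟨exp B * (exp (-η) - y), exp B * (exp η - y), ?_, ?_, ?_, fun z' => ?_⟩
  · exact mul_nonpos_of_nonneg_of_nonpos (exp_pos _).le (by linarith)
  · exact mul_nonneg (exp_pos _).le (by linarith)
  · apply le_of_eq; ring
  · have hs := auxPhi_step g g' η h t z'
    have h0 := auxPhi_nonneg g t z'
    have hB := auxPhi_le g B hg t z'
    have e : auxG Q τ g g' z z' = auxPhi g' t z' - y * auxPhi g t z' := rfl
    rw [e]
    constructor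
    · nlinarith [hs.1, mul_nonneg (sub_nonneg.2 hB) (sub_nonneg.2 hy1)]
    · nlinarith [hs.2, mul_nonneg (sub_nonneg.2 hB) (sub_nonneg.2 hy2)]

theorem auxG_zero {X : Type*} [MeasurableSpace X] (Q : Measure (ℝ × ℝ × X)) [IsProbabilityMeasure Q]
    (τ : ℝ) (hpr : 0 < Q.real {z | τ ≤ z.1})
    (g g' : X → ℝ) (hgm : Measurable g) (hgm' : Measurable g') (B : ℝ) (hg : ∀ x, |g x| ≤ B)
    (hg' : ∀ x, |g' x| ≤ B) (z : ℝ × ℝ × X) : ∫ z', auxG Q τ g g' z z' ∂Q = 0 := by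
  unfold auxG
  have hpos := auxMu_pos Q g hgm B hg (min z.1 τ) τ (min_le_right _ _) hpr
  rw [integral_sub (auxPhi_int Q g' hgm' B hg' _) ((auxPhi_int Q g hgm B hg _).const_mul _),
    integral_const_mul]
  change auxMu Q g' _ - _ / _ * auxMu Q g _ = 0
  field_simp
  simp

theorem aux_hoeff {X : Type*} [MeasurableSpace X] (Q : Measure (ℝ × ℝ × X)) [IsProbabilityMeasure Q]
    (n : ℕ) (hn : 0 < n) (τ pr : ℝ) (hpr : pr = Q.real {z | τ ≤ z.1}) (hpos : 0 < pr) :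
    (Measure.pi fun _ : Fin n => Q).real
      {z | (n:ℝ) * pr / 2 ≤ ∑ j, (pr - if τ ≤ (z j).1 then 1 else 0)} ≤ exp (-(n * pr^2/2)) := by
  have hms : MeasurableSet {z : ℝ × ℝ × X | τ ≤ z.1} := measurableSet_le measurable_const measurable_fst
  have hmeas : Measurable (fun z : ℝ × ℝ × X => pr - if τ ≤ z.1 then (1:ℝ) else 0) :=
    measurable_const.sub (Measurable.ite hms measurable_const measurable_const)
  have hint : ∫ z : ℝ × ℝ × X, (pr - if τ ≤ z.1 then (1:ℝ) else 0) ∂Q = 0 := by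
    have e : (fun z : ℝ × ℝ × X => if τ ≤ z.1 then (1:ℝ) else 0) = {z : ℝ × ℝ × X | τ ≤ z.1}.indicator 1 := by
      ext z; simp [Set.indicator_apply]
    have hi : Integrable (fun z : ℝ × ℝ × X => if τ ≤ z.1 then (1:ℝ) else 0) Q := by
      rw [e]; exact (integrable_const (1:ℝ)).indicator hms
    rw [integral_sub (integrable_const _) hi, e, integral_indicator_one hms]
    simp [hpr]
  have hind := iIndepFun_pi (μ := fun _ : Fin n => Q)
    (X := fun _ (z : ℝ × ℝ × X) => pr - if τ ≤ z.1 then (1:ℝ) else 0)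
    (fun _ => hmeas.aemeasurable)
  have hsub : ∀ j : Fin n, HasSubgaussianMGF
      (fun z : Fin n → ℝ × ℝ × X => pr - if τ ≤ (z j).1 then (1:ℝ) else 0) ((‖pr - (pr - 1)‖₊ / 2) ^ 2)
      (Measure.pi fun _ : Fin n => Q) := by
    intro j
    refine hasSubgaussianMGF_of_mem_Icc_of_integral_eq_zero
      (hmeas.comp (measurable_pi_apply j)).aemeasurable (Filter.Eventually.of_forall fun z => ?_) ?_
    · split_ifs <;> constructor <;> linarith
    · have mp := measurePreserving_eval (fun _ : Fin n => Q) j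
      have h := integral_map mp.aemeasurable (hmeas.aestronglyMeasurable (μ := Measure.map (Function.eval j) (Measure.pi fun _ : Fin n => Q)))
      rw [mp.map_eq, hint] at h
      exact h.symm
  have := HasSubgaussianMGF.measure_sum_ge_le_of_iIndepFun hind (s := Finset.univ) (fun i _ => hsub i)
    (ε := n * pr / 2) (by positivity)
  refine this.trans (le_of_eq ?_)
  congr 1
  have hn' : (n:ℝ) ≠ 0 := by positivity
  simp
  field_simp

set_option maxHeartbeats 1600000 in
theorem aux_core {X : Type*} [MeasurableSpace X] (Q : Measure (ℝ × ℝ × X)) [IsProbabilityMeasure Q]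
    (n : ℕ) (hn : 0 < n) (τ pr : ℝ) (hpr : pr = Q.real {z | τ ≤ z.1}) (hpos : 0 < pr)
    (f fs : X → ℝ) (hfm : Measurable f) (hfsm : Measurable fs) (B : ℝ) (hf : ∀ x, |f x| ≤ B)
    (hfs : ∀ x, |fs x| ≤ B) (H : ℝ) (hH : 0 < H) (hfH : ∀ x, |f x - fs x| ≤ H) (s : ℝ) (hs : 0 < s) :
    (Measure.pi fun _ : Fin n => Q).real
      {z | (∀ i, (z i).1 ≤ τ) ∧ 4 * H * exp B ^ 2 / pr * (s / √n) ≤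
        (n:ℝ)⁻¹ * ∑ i, |(log ((n:ℝ)⁻¹ * ∑ j, auxPhi f (z i).1 (z j)) - log (auxMu Q f (z i).1)) -
          (log ((n:ℝ)⁻¹ * ∑ j, auxPhi fs (z i).1 (z j)) - log (auxMu Q fs (z i).1))|}
      ≤ exp (-(n * pr^2/2)) + 2 * exp 4 * exp (-s^2) := by
  obtain ⟨N, hN⟩ := exists_nat_gt (18 * H)
  have hNpos' : (0:ℝ) < N := by linarith
  have hNpos : 0 < N := by exact_mod_cast hNpos'
  have hn' : (0:ℝ) < n := by exact_mod_cast hn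
  set η := H / N with hη
  have hη0 : 0 < η := by positivity
  have hη1 : η ≤ 1 / 18 := by rw [hη, div_le_iff₀ hNpos']; linarith
  set g : ℕ → X → ℝ := fun l x => fs x + (l / N) * (f x - fs x) with hg
  have hgm : ∀ l, Measurable (g l) := fun l => hfsm.add (measurable_const.mul (hfm.sub hfsm))
  have hg0 : g 0 = fs := by ext x; simp [hg]
  have hgN : g N = f := by ext x; simp [hg]; field_simp; ring
  have hgB : ∀ l, l ≤ N → ∀ x, |g l x| ≤ B := by
    intro l hl x
    have h1 := abs_le.1 (hf x)
    have h2 := abs_le.1 (hfs x)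
    have hu0 : (0:ℝ) ≤ (l:ℝ) / N := by positivity
    have hu1 : (l:ℝ) / N ≤ 1 := by rw [div_le_one hNpos']; exact_mod_cast hl
    have e : g l x = (1 - (l:ℝ)/N) * fs x + (l:ℝ)/N * f x := by simp only [hg]; ring
    rw [e, abs_le]
    constructor <;> nlinarith
  have hgs : ∀ l, ∀ x, |g (l+1) x - g l x| ≤ η := by
    intro l x
    have e : g (l+1) x - g l x = (f x - fs x) / N := by simp only [hg]; push_cast; ring
    rw [e, abs_div, abs_of_pos hNpos', hη]
    gcongr; exact hfH x
  have hprQ : 0 < Q.real {z | τ ≤ z.1} := hpr ▸ hpos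
  set G : Fin N → (ℝ × ℝ × X) → (ℝ × ℝ × X) → ℝ := fun k => auxG Q τ (g k) (g (k+1)) with hG
  set w := exp B * (exp η - exp (-η)) with hw
  have hexp : exp (-η) < exp η := exp_lt_exp.2 (by linarith)
  have hw0 : 0 < w := mul_pos (exp_pos _) (by linarith)
  set α := pr * exp (-B) / 2 with hα
  have hα0 : 0 < α := by positivity
  set x := 2 * η * exp B * exp (-η) * s * √n with hx
  have hsqn : 0 < √(n:ℝ) := by positivity
  have hsqn1 : 1 ≤ √(n:ℝ) := by
    rw [Real.one_le_sqrt]; exact_mod_cast hn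
  have hsq : √(n:ℝ) * √n = n := Real.mul_self_sqrt hn'.le
  set l := 3 * s / √n / w with hl
  have hl0 : 0 ≤ l := by positivity
  have htail := aux_tail Q n N hn hNpos G (fun k => auxG_meas Q τ _ _ (hgm _) (hgm _)) w
    (fun k z => auxG_range Q τ hprQ _ _ (hgm _) (hgm _) B (hgB _ k.2.le) (hgB _ k.2) η (hgs _) z)
    (fun k z => auxG_zero Q τ hprQ _ _ (hgm _) (hgm _) B (hgB _ k.2.le) (hgB _ k.2) z) l hl0 x
  have hlw : l * w = 3 * s / √n := by rw [hl]; field_simp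
  have hlw1 : l * w ≤ 3 * s := by
    rw [hlw]; exact div_le_self (by positivity) hsqn1
  have hlw2 : n * (l^2 * w^2 / 8) = 9 / 8 * s^2 := by
    rw [← mul_pow, hlw, div_pow, Real.sq_sqrt hn'.le]; field_simp; norm_num
  have hlx : 27 / 10 * s^2 ≤ l * x := by
    have e : l * x = 3 * s^2 * (2 * η * exp B * exp (-η) / w) := by
      rw [hl, hx]; field_simp
    rw [e]
    have : 9/10 ≤ 2 * η * exp B * exp (-η) / w := by
      rw [le_div_iff₀ hw0, hw]
      have h1 : exp (2*η) ≤ 1 + 2 * η + (2*η)^2 := by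
        have := Real.abs_exp_sub_one_sub_id_le (x := 2*η) (by rw [abs_of_pos (by positivity)]; linarith)
        linarith [(abs_le.1 this).2]
      have h2 : exp η = exp (2*η) * exp (-η) := by rw [← exp_add]; ring_nf
      have h3 : exp η - exp (-η) ≤ exp (-η) * (2 * η / (9/10)) := by
        rw [h2]
        have : exp (2*η) - 1 ≤ 2 * η / (9/10) := by nlinarith
        nlinarith [exp_pos (-η)]
      calc _ ≤ 9/10 * (exp B * (exp (-η) * (2 * η / (9/10)))) := by gcongr
        _ = _ := by ring
    nlinarith [mul_le_mul_of_nonneg_left this (sq_nonneg s)]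
  have htail2 : (Measure.pi fun _ : Fin n => Q).real
      {z | x ≤ ∑ k, ∑ i, ((N:ℝ) * n)⁻¹ * |∑ j, G k (z i) (z j)|} ≤ 2 * exp 4 * exp (-s^2) := by
    refine htail.trans ?_
    rw [mul_assoc, ← exp_add]
    refine mul_le_mul_of_nonneg_left (exp_le_exp.2 ?_) (by norm_num)
    rw [hlw2]
    have hq : 3 * s ≤ 4 + 23/40 * s^2 := by nlinarith only [sq_nonneg (s - 60/23)]
    linarith only [hq, hlx, hlw1]
  have hho := aux_hoeff Q n hn τ pr hpr hpos
  refine le_trans ?_ (add_le_add hho htail2)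
  refine le_trans (measureReal_mono ?_ (measure_ne_top _ _)) (measureReal_union_le _ _)
  rintro z ⟨hzτ, hz⟩
  by_contra hcon
  simp only [Set.mem_union, Set.mem_setOf_eq, not_or, not_le] at hcon
  obtain ⟨hc1, hc2⟩ := hcon
  have hc3 : pr / 2 ≤ (n:ℝ)⁻¹ * ∑ j, (if τ ≤ (z j).1 then (1:ℝ) else 0) := by
    rw [Finset.sum_sub_distrib] at hc1
    simp only [sum_const, card_univ, Fintype.card_fin, nsmul_eq_mul] at hc1
    rw [inv_mul_eq_div, le_div_iff₀ hn']
    linarith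
  have hlow : ∀ i, ∀ k, k ≤ N → α ≤ (n:ℝ)⁻¹ * ∑ j, auxPhi (g k) (z i).1 (z j) := by
    intro i k hk
    calc α = exp (-B) * (pr / 2) := by rw [hα]; ring
      _ ≤ exp (-B) * ((n:ℝ)⁻¹ * ∑ j, (if τ ≤ (z j).1 then (1:ℝ) else 0)) := by gcongr
      _ = (n:ℝ)⁻¹ * ∑ j, exp (-B) * (if τ ≤ (z j).1 then (1:ℝ) else 0) := by
          rw [← Finset.mul_sum]; ring
      _ ≤ _ := by
          refine mul_le_mul_of_nonneg_left (Finset.sum_le_sum fun j _ => ?_) (by positivity)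
          exact auxPhi_lower (g k) B (hgB k hk) _ τ (hzτ i) _
  have hD : ∀ i, |(log ((n:ℝ)⁻¹ * ∑ j, auxPhi f (z i).1 (z j)) - log (auxMu Q f (z i).1)) -
          (log ((n:ℝ)⁻¹ * ∑ j, auxPhi fs (z i).1 (z j)) - log (auxMu Q fs (z i).1))|
      ≤ ∑ k : Fin N, exp η / α * ((n:ℝ)⁻¹ * |∑ j, G k (z i) (z j)|) := by
    intro i
    set A : ℕ → ℝ := fun k => log ((n:ℝ)⁻¹ * ∑ j, auxPhi (g k) (z i).1 (z j)) - log (auxMu Q (g k) (z i).1) with hA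
    have e := Finset.sum_range_sub A N
    have e0 : A N - A 0 = (log ((n:ℝ)⁻¹ * ∑ j, auxPhi f (z i).1 (z j)) - log (auxMu Q f (z i).1)) -
          (log ((n:ℝ)⁻¹ * ∑ j, auxPhi fs (z i).1 (z j)) - log (auxMu Q fs (z i).1)) := by
      simp only [hA, hg0, hgN]
    rw [← e0, ← e, ← Fin.sum_univ_eq_sum_range (fun k => A (k+1) - A k) N]
    refine (Finset.abs_sum_le_sum_abs _ _).trans (Finset.sum_le_sum fun k _ => ?_)
    have hstep := aux_log_step ((n:ℝ)⁻¹ * ∑ j, auxPhi (g k) (z i).1 (z j))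
      ((n:ℝ)⁻¹ * ∑ j, auxPhi (g (k+1)) (z i).1 (z j)) (auxMu Q (g k) (z i).1)
      (auxMu Q (g (k+1)) (z i).1) η α hα0 (hlow i k k.2.le)
      (auxMu_pos Q _ (hgm _) B (hgB _ k.2.le) _ τ (hzτ i) hprQ)
      (by
        rw [mul_left_comm, Finset.mul_sum]
        refine mul_le_mul_of_nonneg_left (Finset.sum_le_sum fun j _ => ?_) (by positivity)
        exact (auxPhi_step _ _ η (hgs k) _ _).1)
      (auxMu_step Q _ _ (hgm _) (hgm _) B (hgB _ k.2.le) (hgB _ k.2) η (hgs k) _).1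
    refine hstep.trans (le_of_eq ?_)
    congr 1
    rw [← abs_of_pos (inv_pos.2 hn'), ← abs_mul, abs_of_pos (inv_pos.2 hn')]
    congr 1
    simp only [hG, auxG, min_eq_left (hzτ i)]
    rw [Finset.sum_sub_distrib, ← Finset.mul_sum]
    ring
  have hfin : (n:ℝ)⁻¹ * ∑ i, |(log ((n:ℝ)⁻¹ * ∑ j, auxPhi f (z i).1 (z j)) - log (auxMu Q f (z i).1)) -
          (log ((n:ℝ)⁻¹ * ∑ j, auxPhi fs (z i).1 (z j)) - log (auxMu Q fs (z i).1))|
      ≤ exp η / α * N * (n:ℝ)⁻¹ * ∑ k, ∑ i, ((N:ℝ) * n)⁻¹ * |∑ j, G k (z i) (z j)| := by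
    calc _ ≤ (n:ℝ)⁻¹ * ∑ i, ∑ k : Fin N, exp η / α * ((n:ℝ)⁻¹ * |∑ j, G k (z i) (z j)|) := by
          gcongr with i _; exact hD i
      _ = _ := by
          rw [Finset.sum_comm]
          simp_rw [Finset.mul_sum]
          refine Finset.sum_congr rfl fun k _ => Finset.sum_congr rfl fun i _ => ?_
          field_simp
  have hlt : exp η / α * N * (n:ℝ)⁻¹ * ∑ k, ∑ i, ((N:ℝ) * n)⁻¹ * |∑ j, G k (z i) (z j)|
      < exp η / α * N * (n:ℝ)⁻¹ * x := by
    have : 0 < exp η / α * N * (n:ℝ)⁻¹ := by positivity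
    exact mul_lt_mul_of_pos_left hc2 this
  have heq : exp η / α * N * (n:ℝ)⁻¹ * x = 4 * H * exp B ^ 2 / pr * (s / √n) := by
    rw [hx, hα, hη, exp_neg B, exp_neg]
    field_simp
    rw [Real.sq_sqrt hn'.le]
    ring
  linarith

theorem lasso_cox_corollary_3_2 :
    ∃ W : ℝ, 0 < W ∧
      ∀
    (Ω : Type u) [MeasurableSpace Ω] (𝓧 : Type v) [MeasurableSpace 𝓧] [Nonempty 𝓧]
    (P : Measure Ω) [IsProbabilityMeasure P]
    (n m : ℕ) (hn : 0 < n) (hm : 1 ≤ m)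
    (τ : ℝ) (hτ : 0 < τ)
    (Y : Ω → ℝ) (Δ : Ω → ℝ) (X : Ω → 𝓧)
    (hYmeas : Measurable Y) (hΔmeas : Measurable Δ) (hXmeas : Measurable X)
    (hYrange : ∀ ω, Y ω ∈ Set.Icc 0 τ) (hΔrange : ∀ ω, Δ ω = 0 ∨ Δ ω = 1)
    (pr : ℝ) (hprdef : pr = (P {ω | τ ≤ Y ω}).toReal) (hprpos : 0 < pr)
    (Yi : Fin n → Ω → ℝ) (Δi : Fin n → Ω → ℝ) (Xi : Fin n → Ω → 𝓧)
    (hsamplemeas : ∀ i, Measurable (fun ω => (Yi i ω, Δi i ω, Xi i ω)))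
    (hindep : iIndepFun (fun i ω => (Yi i ω, Δi i ω, Xi i ω)) P)
    (hident : ∀ i, IdentDistrib (fun ω => (Yi i ω, Δi i ω, Xi i ω)) (fun ω => (Y ω, Δ ω, X ω)) P P)
    (ψ : Fin m → 𝓧 → ℝ)
    (hψmeas : ∀ k, Measurable (ψ k))
    (hψbdd : ∀ k, BddAbove (Set.range fun x => |ψ k x|))
    (σ : Fin m → ℝ)
    (hσdef : ∀ k, σ k = Real.sqrt (∫ ω, (ψ k (X ω))^2 ∂P))
    (hσpos : ∀ k, 0 < σ k)
    (Km : ℝ) (hKm : Km = ⨆ k, (⨆ x, |ψ k x|) / σ k)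
    (Θ : Set (Fin m → ℝ)) (hΘconv : Convex ℝ Θ) (hΘne : Θ.Nonempty)
    (Lm : ℝ) (hLm : Lm = ⨆ θ : Θ, ∑ k, |(θ : Fin m → ℝ) k|)
    (hLbdd : BddAbove (Set.range fun θ : Θ => ∑ k, |(θ : Fin m → ℝ) k|))
    (fθ : (Fin m → ℝ) → 𝓧 → ℝ) (hfθ : ∀ θ x, fθ θ x = ∑ k, θ k * ψ k x)
    (Inorm : (Fin m → ℝ) → ℝ) (hInorm : ∀ θ, Inorm θ = ∑ k, σ k * |θ k|)
    (σmax : ℝ) (hσmax : σmax = ⨆ k, σ k)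
    (Um : ℝ) (hUm : Um = Real.exp (Km * Lm * σmax))
    (μ : (𝓧 → ℝ) → ℝ → ℝ)
    (hμ : ∀ g t, μ g t = ∫ ω, (if t ≤ Y ω then Real.exp (g (X ω)) else 0) ∂P)
    (γ : (Fin m → ℝ) → 𝓧 → ℝ → ℝ → ℝ)
    (hγ : ∀ θ x y dl, γ θ x y dl = -(fθ θ x - Real.log (μ (fθ θ) y)) * dl)
    (ltil : (Fin m → ℝ) → Ω → ℝ)
    (hltil : ∀ θ ω, ltil θ ω = (n:ℝ)⁻¹ * ∑ i, γ θ (Xi i ω) (Yi i ω) (Δi i ω))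
    (lpl : (Fin m → ℝ) → Ω → ℝ)
    (hlpl : ∀ θ ω, lpl θ ω = -((n:ℝ)⁻¹ * ∑ i, Δi i ω *
      (fθ θ (Xi i ω) - Real.log ((n:ℝ)⁻¹ * ∑ j, if Yi i ω ≤ Yi j ω then Real.exp (fθ θ (Xi j ω)) else 0))))
    (an abar : ℝ)
    (han : an = Real.sqrt (2 * Km^2 * Real.log (2*m) / n) + Km * Real.log (2*m) / n)
    (habar : abar = 4 * an)
    (θstar : Fin m → ℝ) (hθstarΘ : θstar ∈ Θ)
    (R : (Fin m → ℝ) → Ω → ℝ)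
    (hR : ∀ θ ω, R θ ω = |(lpl θ ω - ltil θ ω) - (lpl θstar ω - ltil θstar ω)|),
      ∀ M : ℝ, 0 < M → ∀ r₁ : ℝ, 0 < r₁ → ∀ θ ∈ Θ, Inorm (θ - θstar) ≤ M →
        (P {ω | (2 * Km * Um^2 / pr) * (2 * abar * r₁ + Real.sqrt (Real.log (2*m) / n)) * M ≤
            R θ ω}).toReal ≤
          2 * Real.exp (-(n * pr^2 / 2)) + 3/10 * W^2 * Real.exp (-(n * abar^2 * r₁^2)) := by
  refine ⟨exp 4, exp_pos _, ?_⟩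
  intro Ω _ 𝓧 _ _ P _ n m hn hm τ hτ Y Δ X hYmeas hΔmeas hXmeas hYrange hΔrange pr hprdef hprpos
    Yi Δi Xi hsamplemeas hindep hident ψ hψmeas hψbdd σ hσdef hσpos Km hKm Θ hΘconv hΘne Lm hLm hLbdd
    fθ hfθ Inorm hInorm σmax hσmax Um hUm μ hμ γ hγ ltil hltil lpl hlpl an abar han habar θstar hθstarΘ
    R hR M hM r₁ hr₁ θ hθ hI
  have hn' : (0:ℝ) < n := by exact_mod_cast hn
  have hsq : √(n:ℝ) ^ 2 = n := Real.sq_sqrt hn'.le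
  have hsqn : 0 < √(n:ℝ) := by positivity
  have hK0 : 0 ≤ Km := by
    rw [hKm]
    exact Real.iSup_nonneg fun k => div_nonneg (Real.iSup_nonneg fun x => abs_nonneg _) (hσpos k).le
  have hψK : ∀ k x, |ψ k x| ≤ Km * σ k := by
    intro k x
    rw [← div_le_iff₀ (hσpos k), hKm]
    refine le_trans ?_ (le_ciSup (Set.finite_range _).bddAbove k)
    exact div_le_div_of_nonneg_right (le_ciSup (hψbdd k) x) (hσpos k).le
  have hlog : 0 ≤ Real.log (2 * m) := by
    apply Real.log_nonneg
    have : (1:ℝ) ≤ m := by exact_mod_cast hm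
    linarith
  have han0 : 0 ≤ an := by rw [han]; positivity
  have habar0 : 0 ≤ abar := by rw [habar]; positivity
  set s := √(n:ℝ) * abar * r₁ with hs
  have hs0 : 0 ≤ s := by positivity
  have hs2 : n * abar^2 * r₁^2 = s^2 := by rw [hs, mul_pow, mul_pow, hsq]
  have he4 : (16:ℝ) ≤ exp 4 := by
    have h1 : (2:ℝ) ≤ exp 1 := by have := Real.add_one_le_exp 1; linarith
    have h2 : exp 4 = exp 1 ^ 4 := by rw [← Real.exp_nat_mul]; norm_num
    rw [h2]
    calc (16:ℝ) = 2^4 := by norm_num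
      _ ≤ _ := by gcongr
  rw [hs2]
  rcases hs0.eq_or_lt with hs00 | hspos
  · rw [← hs00]
    have h1 : (P {ω | (2 * Km * Um^2 / pr) * (2 * abar * r₁ + Real.sqrt (Real.log (2*m) / n)) * M ≤
            R θ ω}).toReal ≤ 1 := measureReal_le_one
    have h2 := exp_pos (-(n * pr^2 / 2))
    simp only [ne_eq, OfNat.ofNat_ne_zero, not_false_eq_true, zero_pow, neg_zero, exp_zero]
    nlinarith
  have hKpos : 0 < Km := by
    rcases hK0.eq_or_lt with h | h
    · exfalso
      have : an = 0 := by rw [han, ← h]; simp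
      rw [hs, habar, this] at hspos
      simp at hspos
    · exact h
  set Z : Ω → ℝ × ℝ × 𝓧 := fun ω => (Y ω, Δ ω, X ω) with hZ
  have hZm : Measurable Z := hYmeas.prodMk (hΔmeas.prodMk hXmeas)
  set Q := P.map Z with hQ
  have hQp : IsProbabilityMeasure Q := Measure.isProbabilityMeasure_map hZm.aemeasurable
  have hpi : P.map (fun ω i => (Yi i ω, Δi i ω, Xi i ω)) = Measure.pi fun _ : Fin n => Q := by
    rw [(iIndepFun_iff_map_fun_eq_pi_map fun i => (hsamplemeas i).aemeasurable).1 hindep]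
    congr 1
    ext1 i
    exact (hident i).map_eq
  have hprQ : pr = Q.real {z | τ ≤ z.1} := by
    rw [hprdef, hQ, map_measureReal_apply hZm (measurableSet_le measurable_const measurable_fst)]
    rfl
  have hfm : ∀ θ, Measurable (fθ θ) := by
    intro θ
    have : fθ θ = fun x => ∑ k, θ k * ψ k x := by ext x; exact hfθ θ x
    rw [this]
    exact Finset.measurable_sum _ fun k _ => measurable_const.mul (hψmeas k)
  have hμQ : ∀ θ t, μ (fθ θ) t = auxMu Q (fθ θ) t := by
    intro θ t
    rw [hμ, auxMu, hQ, integral_map hZm.aemeasurable]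
    · rfl
    · exact ((auxPhi_meas _ (hfm θ)).comp (measurable_const.prodMk measurable_id)).aestronglyMeasurable
  have hfB : ∀ θ ∈ Θ, ∀ x, |fθ θ x| ≤ Km * Lm * σmax := by
    intro θ hθ x
    rw [hfθ]
    have hL : ∑ k, |θ k| ≤ Lm := by
      rw [hLm]; exact le_ciSup hLbdd ⟨θ, hθ⟩
    have hσm : ∀ k, σ k ≤ σmax := by
      intro k; rw [hσmax]; exact le_ciSup (Set.finite_range _).bddAbove k
    have hσm0 : 0 ≤ σmax := (hσpos ⟨0, hm⟩).le.trans (hσm _)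
    calc |∑ k, θ k * ψ k x| ≤ ∑ k, |θ k * ψ k x| := Finset.abs_sum_le_sum_abs _ _
      _ ≤ ∑ k, |θ k| * (Km * σmax) := by
          refine Finset.sum_le_sum fun k _ => ?_
          rw [abs_mul]
          refine mul_le_mul_of_nonneg_left ((hψK k x).trans ?_) (abs_nonneg _)
          exact mul_le_mul_of_nonneg_left (hσm k) hK0
      _ = (∑ k, |θ k|) * (Km * σmax) := by rw [Finset.sum_mul]
      _ ≤ Lm * (Km * σmax) := by gcongr
      _ = _ := by ring
  have hfH : ∀ x, |fθ θ x - fθ θstar x| ≤ Km * M := by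
    intro x
    rw [hfθ, hfθ, ← Finset.sum_sub_distrib]
    rw [hInorm] at hI
    calc _ ≤ ∑ k, |θ k * ψ k x - θstar k * ψ k x| := Finset.abs_sum_le_sum_abs _ _
      _ ≤ ∑ k, Km * (σ k * |(θ - θstar) k|) := by
          refine Finset.sum_le_sum fun k _ => ?_
          rw [← sub_mul, abs_mul, Pi.sub_apply]
          calc _ ≤ |θ k - θstar k| * (Km * σ k) := by gcongr; exact hψK k x
            _ = _ := by ring
      _ = Km * ∑ k, σ k * |(θ - θstar) k| := by rw [Finset.mul_sum]
      _ ≤ _ := by gcongr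
  have hcore := aux_core Q n hn τ pr hprQ hprpos (fθ θ) (fθ θstar) (hfm _) (hfm _) (Km * Lm * σmax)
    (hfB θ hθ) (hfB θstar hθstarΘ) (Km * M) (by positivity) hfH s hspos
  have hae : ∀ᵐ ω ∂P, ∀ i, Yi i ω ≤ τ ∧ (Δi i ω = 0 ∨ Δi i ω = 1) := by
    rw [ae_all_iff]
    intro i
    have hms : MeasurableSet {z : ℝ × ℝ × 𝓧 | z.1 ≤ τ ∧ (z.2.1 = 0 ∨ z.2.1 = 1)} := by
      refine (measurableSet_le measurable_fst measurable_const).inter ?_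
      have h21 : Measurable (fun z : ℝ × ℝ × 𝓧 => z.2.1) := by fun_prop
      exact (h21 (measurableSet_singleton 0)).union (h21 (measurableSet_singleton 1))
    exact (hident i).symm.ae_snd (p := fun z => z.1 ≤ τ ∧ (z.2.1 = 0 ∨ z.2.1 = 1)) hms
      (Filter.Eventually.of_forall fun ω => ⟨(hYrange ω).2, hΔrange ω⟩)
  have hZZ : Measurable (fun ω i => (Yi i ω, Δi i ω, Xi i ω)) := measurable_pi_lambda _ hsamplemeas
  set bad : Set (Fin n → ℝ × ℝ × 𝓧) := {z | (∀ i, (z i).1 ≤ τ) ∧ 4 * (Km * M) * exp (Km * Lm * σmax) ^ 2 / pr * (s / √n) ≤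
        (n:ℝ)⁻¹ * ∑ i, |(log ((n:ℝ)⁻¹ * ∑ j, auxPhi (fθ θ) (z i).1 (z j)) - log (auxMu Q (fθ θ) (z i).1)) -
          (log ((n:ℝ)⁻¹ * ∑ j, auxPhi (fθ θstar) (z i).1 (z j)) - log (auxMu Q (fθ θstar) (z i).1))|} with hbad
  have hle1 : P {ω | (2 * Km * Um^2 / pr) * (2 * abar * r₁ + Real.sqrt (Real.log (2*m) / n)) * M ≤
            R θ ω} ≤ P ((fun ω i => (Yi i ω, Δi i ω, Xi i ω)) ⁻¹' bad) := by
    refine measure_mono_ae ?_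
    filter_upwards [hae] with ω hω hmem
    refine ⟨fun i => (hω i).1, ?_⟩
    have hmem' : (2 * Km * Um^2 / pr) * (2 * abar * r₁ + Real.sqrt (Real.log (2*m) / n)) * M ≤
            R θ ω := hmem
    have hthr : 4 * (Km * M) * exp (Km * Lm * σmax) ^ 2 / pr * (s / √n) ≤ (2 * Km * Um^2 / pr) * (2 * abar * r₁ + Real.sqrt (Real.log (2*m) / n)) * M := by
      have e : s / √(n:ℝ) = abar * r₁ := by rw [hs]; field_simp
      rw [e, ← hUm]
      calc _ = (2 * Km * Um^2 / pr) * (2 * abar * r₁ + 0) * M := by ring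
        _ ≤ _ := by gcongr; positivity
    refine (hthr.trans hmem').trans ?_
    have hdiff : ∀ θ, lpl θ ω - ltil θ ω = (n:ℝ)⁻¹ * ∑ i, Δi i ω *
        (log ((n:ℝ)⁻¹ * ∑ j, auxPhi (fθ θ) (Yi i ω) (Yi j ω, Δi j ω, Xi j ω)) - log (auxMu Q (fθ θ) (Yi i ω))) := by
      intro θ
      rw [hlpl, hltil, ← mul_neg, ← mul_sub, ← Finset.sum_neg_distrib, ← Finset.sum_sub_distrib]
      congr 1
      refine Finset.sum_congr rfl fun i _ => ?_
      rw [hγ, hμQ]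
      simp only [auxPhi]
      ring
    rw [hR, hdiff, hdiff, ← mul_sub, ← Finset.sum_sub_distrib, abs_mul, abs_of_pos (inv_pos.2 hn')]
    refine mul_le_mul_of_nonneg_left ?_ (inv_pos.2 hn').le
    refine (Finset.abs_sum_le_sum_abs _ _).trans (Finset.sum_le_sum fun i _ => ?_)
    rw [← mul_sub, abs_mul]
    refine mul_le_of_le_one_left (abs_nonneg _) ?_
    rcases (hω i).2 with h | h <;> rw [h] <;> simp
  have hle2 : P ((fun ω i => (Yi i ω, Δi i ω, Xi i ω)) ⁻¹' bad) ≤ (Measure.pi fun _ : Fin n => Q) bad := by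
    rw [← hpi]
    exact Measure.le_map_apply hZZ.aemeasurable bad
  have hle3 := ENNReal.toReal_mono (measure_ne_top _ _) (hle1.trans hle2)
  refine hle3.trans (le_trans hcore ?_)
  have h5 := exp_pos (-(n * pr^2 / 2))
  have h6 := exp_pos (-s^2)
  have h7 : 2 * exp 4 ≤ 3/10 * exp 4 ^ 2 := by nlinarith
  have h8 := mul_le_mul_of_nonneg_right h7 h6.le
  linarith
end
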